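/- Let ζ ∈ B(ω,R) be a zero of f = (f₁,…,f_n) ∈ A²(ω,R)^n with Df(ζ) invertible; write γ = γ(f,ζ), κ = κ_ζ, and for x ∈ B(ω,R) set u = κ‖x − ζ‖. If u < 1 − √(γ/(1 + γ)), then Df(x) is invertible and ‖Df(x)^{−1} Df(ζ)‖ ≤ (1 − u)² / ( (1 + γ)(1 − u)² − γ ). -/

import Mathlib

open MeasureTheory Metric

noncomputable section

/-- `ℂⁿ` with the Euclidean (Hermitian) norm. -/
abbrev En (n : ℕ) := EuclideanSpace ℂ (Fin n)

instance (n : ℕ) : InnerProductSpace ℝ (En n) := InnerProductSpace.rclikeToReal ℂ _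
instance (n : ℕ) : MeasurableSpace (En n) := borel _
instance (n : ℕ) : BorelSpace (En n) := ⟨rfl⟩

/-- The `A²(ω,R)` norm: `‖f‖² = (n!/(πⁿ R^{2n})) ∫_{B(ω,R)} ‖f(z)‖² dz`.  For a system
`f = (f₁,…,f_s) : ℂⁿ → ℂˢ` (with `ℂˢ` carrying the Euclidean norm) this is exactly
`(Σᵢ ‖fᵢ‖²)^{1/2}`. -/
def A2Norm {𝓕 : Type*} [NormedAddCommGroup 𝓕] {n : ℕ} (ω : En n) (R : ℝ)
    (f : En n → 𝓕) : ℝ :=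
  Real.sqrt (((n.factorial : ℝ) / (Real.pi ^ n * R ^ (2 * n))) * ∫ z in ball ω R, ‖f z‖ ^ 2)

/-- Membership in `A²(ω,R)`: analytic on the open ball `B(ω,R)` and square integrable there. -/
def MemA2 {𝓕 : Type*} [NormedAddCommGroup 𝓕] [NormedSpace ℂ 𝓕] {n : ℕ}
    (ω : En n) (R : ℝ) (f : En n → 𝓕) : Prop :=
  AnalyticOnNhd ℂ f (ball ω R) ∧ IntegrableOn (fun z => ‖f z‖ ^ 2) (ball ω R)

set_option linter.unusedSectionVars false

section CircleAverages

variable {W : Type*} [NormedAddCommGroup W] [NormedSpace ℂ W] [CompleteSpace W]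

theorem continuousOn_comp_rotation {φ : ℂ → W} (hφ : DifferentiableOn ℂ φ (ball 0 1)) {τ : ℂ}
    (hτ : ‖τ‖ < 1) : Continuous fun θ : ℝ => φ (Complex.exp (θ * Complex.I) * τ) := by
  rw [← continuousOn_univ]
  refine hφ.continuousOn.comp (by fun_prop) fun θ _ => ?_
  simpa [Complex.norm_exp_ofReal_mul_I] using hτ

theorem ofReal_mul_le_lintegral_circle {φ : ℂ → W} (hφ : DifferentiableOn ℂ φ (ball 0 1)) {τ : ℂ}
    (hτ : ‖τ‖ < 1) {b k : ℝ} (hk : 0 ≤ k)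
    (h : 2 * Real.pi * b ≤ ∫ θ in (0 : ℝ)..2 * Real.pi, ‖φ (Complex.exp (θ * Complex.I) * τ)‖) :
    ENNReal.ofReal (2 * Real.pi) * ENNReal.ofReal (b * k)
      ≤ ∫⁻ θ in Set.Ioc 0 (2 * Real.pi),
          ENNReal.ofReal (‖φ (Complex.exp (θ * Complex.I) * τ)‖ * k) := by
  have hc := (continuousOn_comp_rotation hφ hτ).norm.mul_const k
  rw [← ENNReal.ofReal_mul (by positivity), ← ofReal_integral_eq_lintegral_ofReal
    (hc.integrableOn_Ioc) (Filter.Eventually.of_forall fun θ => by positivity)]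
  refine ENNReal.ofReal_le_ofReal ?_
  rw [integral_mul_const, ← intervalIntegral.integral_of_le (by positivity), ← mul_assoc]
  exact mul_le_mul_of_nonneg_right h hk

/-- The Taylor coefficients at the origin of a function on the unit disc are bounded by its
circular means. -/
theorem exists_series_norm_le_circle_mean {φ : ℂ → W} (hφ : DifferentiableOn ℂ φ (ball 0 1)) :
    ∃ p : FormalMultilinearSeries ℂ ℂ W, HasFPowerSeriesAt φ p 0 ∧
      (∀ t, ‖t‖ < 1 → HasSum (fun j => p j fun _ => t) (φ t)) ∧
      ∀ j τ, ‖τ‖ < 1 → 2 * Real.pi * (‖p j‖ * ‖τ‖ ^ j)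
        ≤ ∫ θ in (0 : ℝ)..2 * Real.pi, ‖φ (Complex.exp (θ * Complex.I) * τ)‖ := by
  have key : ∀ r : NNReal, 0 < r → r < 1 →
      HasFPowerSeriesOnBall φ (cauchyPowerSeries φ 0 r) 0 r := fun r h0 h1 =>
    (hφ.mono (closedBall_subset_ball (by exact_mod_cast h1))).hasFPowerSeriesOnBall h0
  have hhalf := key (1 / 2) (by norm_num) (by rw [← NNReal.coe_lt_coe]; norm_num)
  set p := cauchyPowerSeries φ 0 ((1 / 2 : NNReal) : ℝ)
  have huniq : ∀ r : NNReal, 0 < r → r < 1 → p = cauchyPowerSeries φ 0 r := fun r h0 h1 =>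
    hhalf.hasFPowerSeriesAt.eq_formalMultilinearSeries (key r h0 h1).hasFPowerSeriesAt
  refine ⟨p, hhalf.hasFPowerSeriesAt, fun t ht => ?_, fun j τ hτ => ?_⟩
  · obtain ⟨r, hr0, hr1⟩ := exists_between ht
    lift r to NNReal using (norm_nonneg t).trans hr0.le
    have hr : 0 < r := by exact_mod_cast (norm_nonneg t).trans_lt hr0
    have hr1' : r < 1 := by exact_mod_cast hr1
    have := (key r hr hr1').hasSum (y := t) (by simpa [← NNReal.coe_lt_coe] using hr0)
    rw [← huniq r hr hr1'] at this
    simpa using this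
  · rcases eq_or_ne τ 0 with rfl | hne
    · rcases Nat.eq_zero_or_pos j with rfl | hj
      · have : ‖p 0‖ = ‖φ 0‖ := by
          rw [← hhalf.hasFPowerSeriesAt.coeff_zero (fun _ => 0),
            ContinuousMultilinearMap.fin0_apply_norm]
        simp [this]
      · simp only [norm_zero, zero_pow hj.ne', mul_zero]
        exact intervalIntegral.integral_nonneg (by positivity) fun _ _ => norm_nonneg _
    · have hr : (0 : NNReal) < ‖τ‖₊ := by simpa using hne
      have hr1 : ‖τ‖₊ < 1 := by exact_mod_cast hτ
      have h1 := norm_cauchyPowerSeries_le φ 0 ‖τ‖₊ j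
      rw [← huniq _ hr hr1] at h1
      have hper : Function.Periodic (fun θ : ℝ => ‖φ (circleMap 0 ‖τ‖ θ)‖) (2 * Real.pi) :=
        (periodic_circleMap 0 ‖τ‖).comp fun z => ‖φ z‖
      have hshift : ∫ θ in (0 : ℝ)..2 * Real.pi, ‖φ (Complex.exp (θ * Complex.I) * τ)‖
          = ∫ θ in (0 : ℝ)..2 * Real.pi, ‖φ (circleMap 0 ‖τ‖ θ)‖ := by
        have := hper.intervalIntegral_add_eq (Complex.arg τ) 0
        rw [zero_add] at this
        rw [← this, add_comm (Complex.arg τ)]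
        nth_rw 1 [← zero_add (Complex.arg τ)]
        rw [← intervalIntegral.integral_comp_add_right fun θ => ‖φ (circleMap 0 ‖τ‖ θ)‖]
        congr 1
        ext θ
        rw [circleMap_zero]
        conv_lhs => rw [← Complex.norm_mul_exp_arg_mul_I τ]
        push_cast
        rw [add_mul, Complex.exp_add]
        ring_nf
      rw [hshift]
      simp only [coe_nnnorm, abs_norm] at h1
      have hτ0 : 0 < ‖τ‖ := norm_pos_iff.2 hne
      rw [inv_pow, ← div_eq_mul_inv, le_div_iff₀ (by positivity)] at h1
      calc _ ≤ 2 * Real.pi * ((2 * Real.pi)⁻¹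
            * ∫ θ in (0 : ℝ)..2 * Real.pi, ‖φ (circleMap 0 ‖τ‖ θ)‖) := by gcongr
        _ = _ := by field_simp

end CircleAverages

section Rotations

variable {V : Type*} [NormedAddCommGroup V] [InnerProductSpace ℂ V]

/-- The rotation by `e^{iθ}` of the whole space. -/
def rotateAll (θ : ℝ) : V ≃ₗᵢ[ℂ] V :=
  { LinearEquiv.smulOfNeZero ℂ V (Complex.exp (θ * Complex.I)) (Complex.exp_ne_zero _) with
    norm_map' := fun z => by simp [norm_smul, Complex.norm_exp_ofReal_mul_I] }

@[simp] theorem rotateAll_apply (θ : ℝ) (z : V) :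
    rotateAll θ z = Complex.exp (θ * Complex.I) • z := rfl

/-- Rotation by `c` of the orthogonal complement of `v`. -/
def rotateOrthFun (v : V) (c : ℂ) : V →ₗ[ℂ] V where
  toFun z := inner ℂ v z • v + c • (z - inner ℂ v z • v)
  map_add' x y := by simp only [inner_add_right]; module
  map_smul' r x := by simp only [inner_smul_right, RingHom.id_apply]; module

theorem inner_sub_proj_eq_zero {v : V} (hv : ‖v‖ = 1) (z : V) :
    inner ℂ v (z - inner ℂ v z • v) = 0 := by
  simp [inner_self_eq_norm_sq_to_K, hv]

theorem norm_sq_proj_add {v : V} (hv : ‖v‖ = 1) (α c : ℂ) (z : V) :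
    ‖α • v + c • (z - inner ℂ v z • v)‖ ^ 2
      = ‖α‖ ^ 2 + ‖c‖ ^ 2 * ‖z - inner ℂ v z • v‖ ^ 2 := by
  have h : inner ℂ (α • v) (c • (z - inner ℂ v z • v)) = 0 := by
    rw [inner_smul_left, inner_smul_right, inner_sub_proj_eq_zero hv]; simp
  have := norm_add_sq_eq_norm_sq_add_norm_sq_of_inner_eq_zero _ _ h
  simp only [norm_smul, hv, mul_one] at this
  nlinarith

theorem inner_rotateOrthFun {v : V} (hv : ‖v‖ = 1) (c : ℂ) (z : V) :
    inner ℂ v (rotateOrthFun v c z) = inner ℂ v z := by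
  simp only [rotateOrthFun, LinearMap.coe_mk, AddHom.coe_mk, inner_add_right, inner_smul_right,
    inner_sub_proj_eq_zero hv]
  simp [inner_self_eq_norm_sq_to_K, hv]

/-- The rotation by `e^{iθ}` of the orthogonal complement of the unit vector `v`. -/
def rotateOrth {v : V} (hv : ‖v‖ = 1) (θ : ℝ) : V ≃ₗᵢ[ℂ] V :=
  LinearIsometryEquiv.ofSurjective
    { rotateOrthFun v (Complex.exp (θ * Complex.I)) with
      norm_map' := fun z => by
        have h1 := norm_sq_proj_add hv (inner ℂ v z) (Complex.exp (θ * Complex.I)) z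
        have h2 := norm_sq_proj_add hv (inner ℂ v z) 1 z
        rw [one_smul, add_sub_cancel, norm_one] at h2
        rw [Complex.norm_exp_ofReal_mul_I, ← h2] at h1
        exact (pow_left_inj₀ (norm_nonneg _) (norm_nonneg _) two_ne_zero).1 h1 }
    (fun z => by
      have hc := Complex.exp_ne_zero (θ * Complex.I)
      refine ⟨rotateOrthFun v (Complex.exp (θ * Complex.I))⁻¹ z, ?_⟩
      change inner ℂ v (rotateOrthFun v _ z) • v + _ • (_ - inner ℂ v (rotateOrthFun v _ z) • v) = z
      rw [inner_rotateOrthFun hv]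
      simp [rotateOrthFun, smul_smul, hc])

theorem rotateOrth_apply {v : V} (hv : ‖v‖ = 1) (θ : ℝ) (z : V) :
    rotateOrth hv θ z
      = inner ℂ v z • v + Complex.exp (θ * Complex.I) • (z - inner ℂ v z • v) := rfl

theorem inner_rotateOrth {v : V} (hv : ‖v‖ = 1) (θ : ℝ) (z : V) :
    inner ℂ v (rotateOrth hv θ z) = inner ℂ v z := inner_rotateOrthFun hv _ z

theorem norm_inner_unit_le {v : V} (hv : ‖v‖ = 1) (z : V) : ‖inner ℂ v z‖ ≤ ‖z‖ := by
  simpa [hv] using norm_inner_le_norm (𝕜 := ℂ) v z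

end Rotations

section Slices

variable {V W : Type*} [NormedAddCommGroup V] [InnerProductSpace ℂ V] [InnerProductSpace ℝ V]
  [IsScalarTower ℝ ℂ V] [FiniteDimensional ℝ V] [FiniteDimensional ℂ V]
  [MeasurableSpace V] [BorelSpace V]
  [NormedAddCommGroup W] [NormedSpace ℂ W] [CompleteSpace W]

/-- Complex-linear isometries preserve the Lebesgue measure. -/
theorem measurePreserving_complexIsometry (U : V ≃ₗᵢ[ℂ] V) :
    MeasurePreserving U (volume : Measure V) volume :=
  LinearIsometryEquiv.measurePreserving
    ({ U.toLinearEquiv.restrictScalars ℝ with norm_map' := U.norm_map } : V ≃ₗᵢ[ℝ] V)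

theorem preimage_unitBall_isometry (U : V ≃ₗᵢ[ℂ] V) : U ⁻¹' ball (0 : V) 1 = ball 0 1 := by
  ext z; simp

theorem setLIntegral_unitBall_isometry (U : V ≃ₗᵢ[ℂ] V) (F : V → ENNReal) :
    ∫⁻ z in ball (0 : V) 1, F (U z) = ∫⁻ z in ball (0 : V) 1, F z := by
  have h := (measurePreserving_complexIsometry U).setLIntegral_comp_preimage_emb
    U.toHomeomorph.measurableEmbedding F (ball 0 1)
  rwa [preimage_unitBall_isometry] at h

/-- If `H` is bounded by the average of `F` over a circle of isometries, then the integral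
of `H` over the unit ball is at most that of `F`. -/
theorem setLIntegral_le_of_le_average (U : ℝ → V ≃ₗᵢ[ℂ] V)
    (hU : Continuous fun p : ℝ × V => U p.1 p.2) {F : V → ℝ} (hF : ContinuousOn F (ball 0 1))
    {H : V → ENNReal}
    (hH : ∀ z ∈ ball (0 : V) 1,
      ENNReal.ofReal (2 * Real.pi) * H z
        ≤ ∫⁻ θ in Set.Ioc 0 (2 * Real.pi), ENNReal.ofReal (F (U θ z))) :
    ∫⁻ z in ball (0 : V) 1, H z ≤ ∫⁻ z in ball (0 : V) 1, ENNReal.ofReal (F z) := by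
  have hpi : ENNReal.ofReal (2 * Real.pi) ≠ 0 := by simp [Real.pi_pos]
  have hcont : ContinuousOn (fun p : V × ℝ => F (U p.2 p.1))
      (ball (0 : V) 1 ×ˢ Set.Ioc 0 (2 * Real.pi)) :=
    hF.comp (hU.comp continuous_swap).continuousOn fun p hp => by simpa using hp.1
  have hmeas : AEMeasurable (Function.uncurry fun (z : V) (θ : ℝ) => ENNReal.ofReal (F (U θ z)))
      ((volume.restrict (ball (0 : V) 1)).prod
        (volume.restrict (Set.Ioc 0 (2 * Real.pi)))) := by
    rw [Measure.prod_restrict]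
    exact (hcont.aemeasurable (measurableSet_ball.prod measurableSet_Ioc)).ennreal_ofReal
  rw [← ENNReal.mul_le_mul_iff_right hpi ENNReal.ofReal_ne_top]
  calc ENNReal.ofReal (2 * Real.pi) * ∫⁻ z in ball (0 : V) 1, H z
      = ∫⁻ z in ball (0 : V) 1, ENNReal.ofReal (2 * Real.pi) * H z :=
        (lintegral_const_mul' _ _ ENNReal.ofReal_ne_top).symm
    _ ≤ ∫⁻ z in ball (0 : V) 1, ∫⁻ θ in Set.Ioc 0 (2 * Real.pi),
          ENNReal.ofReal (F (U θ z)) := setLIntegral_mono' measurableSet_ball hH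
    _ = ∫⁻ θ in Set.Ioc 0 (2 * Real.pi), ∫⁻ z in ball (0 : V) 1,
          ENNReal.ofReal (F (U θ z)) := lintegral_lintegral_swap hmeas
    _ = ENNReal.ofReal (2 * Real.pi) * ∫⁻ z in ball (0 : V) 1, ENNReal.ofReal (F z) := by
        simp_rw [fun θ => setLIntegral_unitBall_isometry (U θ) fun z => ENNReal.ofReal (F z)]
        simp [mul_comm]

theorem inner_sq_integrableOn (v : V) (j : ℕ) :
    IntegrableOn (fun z : V => ‖inner ℂ v z‖ ^ j) (ball (0 : V) 1) :=
  ((by fun_prop : Continuous fun z : V => ‖inner ℂ v z‖ ^ j).continuousOn.integrableOn_compact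
    (isCompact_closedBall 0 1)).mono_set ball_subset_closedBall

theorem integral_unitBall_isometry (U : V ≃ₗᵢ[ℂ] V) (F : V → ℝ) :
    ∫ z in ball (0 : V) 1, F (U z) = ∫ z in ball (0 : V) 1, F z := by
  have h := (measurePreserving_complexIsometry U).setIntegral_preimage_emb
    U.toHomeomorph.measurableEmbedding F (ball 0 1)
  rwa [preimage_unitBall_isometry] at h

theorem finrank_real_eq_two_mul : Module.finrank ℝ V = 2 * Module.finrank ℂ V := by
  rw [← Module.finrank_mul_finrank ℝ ℂ V, Complex.finrank_real_complex]

theorem integral_norm_sq_unitBall [Nontrivial V] :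
    ∫ z in ball (0 : V) 1, ‖z‖ ^ 2
      = Module.finrank ℂ V / (Module.finrank ℂ V + 1) * volume.real (ball (0 : V) 1) := by
  have h1 : ∫ z in ball (0 : V) 1, ‖z‖ ^ 2
      = ∫ z : V, (Set.Iio (1 : ℝ)).indicator (fun r => r ^ 2) ‖z‖ := by
    rw [← integral_indicator measurableSet_ball]
    congr 1; ext z; simp [Set.indicator]
  have hn : 0 < Module.finrank ℂ V := Module.finrank_pos
  have h2 : ∫ y in Set.Ioi (0 : ℝ), y ^ (Module.finrank ℝ V - 1) •
      (Set.Iio (1 : ℝ)).indicator (fun r => r ^ 2) y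
      = 1 / (2 * (Module.finrank ℂ V + 1)) := by
    have : ∀ y : ℝ, y ^ (Module.finrank ℝ V - 1) • (Set.Iio (1 : ℝ)).indicator (fun r => r ^ 2) y
        = (Set.Iio (1 : ℝ)).indicator (fun r => r ^ (2 * Module.finrank ℂ V + 1)) y := by
      intro y
      rw [finrank_real_eq_two_mul]
      by_cases hy : y < 1
      · simp only [Set.indicator, Set.mem_Iio, hy, if_true, smul_eq_mul, ← pow_add]
        congr 1; omega
      · simp [Set.indicator, hy]
    simp_rw [this]
    rw [setIntegral_indicator measurableSet_Iio, Set.Ioi_inter_Iio, ← integral_Ioc_eq_integral_Ioo,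
      ← intervalIntegral.integral_of_le zero_le_one, integral_pow]
    push_cast
    rw [one_pow, zero_pow (by omega)]
    congr 1 <;> ring
  rw [h1, integral_fun_norm_addHaar volume, h2, finrank_real_eq_two_mul]
  simp only [nsmul_eq_mul, smul_eq_mul]
  push_cast
  field_simp

theorem integral_inner_sq_unitBall {v : V} (hv : ‖v‖ = 1) :
    ∫ z in ball (0 : V) 1, ‖inner ℂ v z‖ ^ 2
      = 1 / (Module.finrank ℂ V + 1) * volume.real (ball (0 : V) 1) := by
  have : Nontrivial V := ⟨v, 0, fun h => by simp [h] at hv⟩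
  classical
  have hon : Orthonormal ℂ ((↑) : ({v} : Set V) → V) := by
    rw [orthonormal_subtype_iff_ite]
    intro x hx y hy
    obtain rfl : x = v := hx
    obtain rfl : y = x := hy
    simp [inner_self_eq_norm_sq_to_K, hv]
  obtain ⟨u, b, hub, hb⟩ := hon.exists_orthonormalBasis_extension
  let i₀ : u := ⟨v, hub rfl⟩
  have hb0 : b i₀ = v := by simp [hb, i₀]
  have hsymm : ∀ i, ∫ z in ball (0 : V) 1, ‖inner ℂ (b i) z‖ ^ 2
      = ∫ z in ball (0 : V) 1, ‖inner ℂ v z‖ ^ 2 := by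
    intro i
    let U := b.equiv b (Equiv.swap i i₀)
    have hU : U (b i) = v := by simp [U, hb0]
    rw [← integral_unitBall_isometry U fun z => ‖inner ℂ v z‖ ^ 2, ← hU]
    simp_rw [LinearIsometryEquiv.inner_map_map]
  have hsum : ∫ z in ball (0 : V) 1, ‖z‖ ^ 2
      = ∑ i, ∫ z in ball (0 : V) 1, ‖inner ℂ (b i) z‖ ^ 2 := by
    rw [← integral_finsetSum _ fun i _ => inner_sq_integrableOn (b i) 2]
    simp_rw [b.sum_sq_norm_inner_right]
  rw [Finset.sum_congr rfl fun i _ => hsymm i, integral_norm_sq_unitBall, Finset.sum_const,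
    Finset.card_univ, ← Module.finrank_eq_card_basis b.toBasis, nsmul_eq_mul] at hsum
  have hn : (0 : ℝ) < Module.finrank ℂ V := by exact_mod_cast Module.finrank_pos
  refine mul_left_cancel₀ hn.ne' (hsum.symm.trans ?_)
  ring

theorem moment_lower_bound {v : V} (hv : ‖v‖ = 1) (j : ℕ) :
    (1 / (Module.finrank ℂ V + 1)) ^ j * volume.real (ball (0 : V) 1)
      ≤ ∫ z in ball (0 : V) 1, (‖inner ℂ v z‖ ^ 2) ^ j := by
  have hvol : 0 < volume.real (ball (0 : V) 1) :=
    ENNReal.toReal_pos (measure_ball_pos _ _ one_pos).ne' measure_ball_lt_top.ne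
  have hJ := (convexOn_pow j).map_set_average_le (μ := (volume : Measure V)) (t := ball (0 : V) 1)
    (f := fun z => ‖inner ℂ v z‖ ^ 2) (by fun_prop) isClosed_Ici
    (measure_ball_pos _ _ one_pos).ne' measure_ball_lt_top.ne
    (Filter.Eventually.of_forall fun z => by simp) (inner_sq_integrableOn v 2)
    (by simpa [Function.comp_def, ← pow_mul] using inner_sq_integrableOn v (2 * j))
  rw [setAverage_eq, setAverage_eq, integral_inner_sq_unitBall hv, smul_eq_mul, smul_eq_mul,
    mul_comm (1 / _), inv_mul_cancel_left₀ hvol.ne', le_inv_mul_iff₀ hvol] at hJ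
  linarith

/-- Taylor coefficients along a complex line of a square integrable analytic function on the
unit ball. -/
theorem exists_slice_series {g : V → W} (hg : DifferentiableOn ℂ g (ball 0 1))
    (hint : IntegrableOn (fun z => ‖g z‖ ^ 2) (ball 0 1)) {v : V} (hv : ‖v‖ = 1) :
    ∃ p : FormalMultilinearSeries ℂ ℂ W, HasFPowerSeriesAt (fun t : ℂ => g (t • v)) p 0 ∧
      (∀ t : ℂ, ‖t‖ < 1 → HasSum (fun j => p j fun _ => t) (g (t • v))) ∧
      ∀ j, ‖p j‖ ^ 2 * volume.real (ball (0 : V) 1)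
        ≤ (Module.finrank ℂ V + 1) ^ j * ∫ z in ball (0 : V) 1, ‖g z‖ ^ 2 := by
  have hφ : DifferentiableOn ℂ (fun t : ℂ => g (t • v)) (ball 0 1) :=
    hg.comp (by fun_prop) fun t ht => by simpa [norm_smul, hv] using ht
  obtain ⟨p, hp, hsum, hmean⟩ := exists_series_norm_le_circle_mean hφ
  refine ⟨p, hp, hsum, fun j => ?_⟩
  have hinner : ∀ z ∈ ball (0 : V) 1, ‖inner ℂ v z‖ < 1 := fun z hz =>
    (norm_inner_unit_le hv z).trans_lt (by simpa using hz)
  have hcont : ContinuousOn (fun z : V => ‖g z‖ * ‖inner ℂ v z‖ ^ j) (ball 0 1) :=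
    hg.continuousOn.norm.mul (by fun_prop)
  have hproj : ContinuousOn (fun z : V => g (inner ℂ v z • v)) (ball 0 1) :=
    hφ.continuousOn.comp (by fun_prop) fun z hz => by simpa using hinner z hz
  have hcont' : ContinuousOn (fun z : V => ‖g (inner ℂ v z • v)‖ * ‖inner ℂ v z‖ ^ j)
      (ball 0 1) := hproj.norm.mul (by fun_prop)
  have hexp : Continuous fun q : ℝ × V => Complex.exp (q.1 * Complex.I) := by fun_prop
  have horth : ∫⁻ z in ball (0 : V) 1, ENNReal.ofReal (‖g (inner ℂ v z • v)‖ * ‖inner ℂ v z‖ ^ j)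
      ≤ ∫⁻ z in ball (0 : V) 1, ENNReal.ofReal (‖g z‖ * ‖inner ℂ v z‖ ^ j) := by
    refine setLIntegral_le_of_le_average (rotateOrth hv)
      (by simp only [rotateOrth_apply]; fun_prop) hcont fun z hz => ?_
    simp only [inner_rotateOrth]
    simp only [rotateOrth_apply]
    rw [mem_ball_zero_iff] at hz
    obtain ⟨r, hr0, hr1⟩ : ∃ r : ℝ, 1 < r ∧ r * ‖z‖ < 1 := by
      rcases eq_or_lt_of_le (norm_nonneg z) with h0 | h0
      · exact ⟨2, by norm_num, by rw [← h0]; norm_num⟩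
      · obtain ⟨r, h1, h2⟩ := exists_between ((one_lt_div h0).2 hz)
        exact ⟨r, h1, (lt_div_iff₀ h0).1 h2⟩
    have hr : 0 < r := by linarith
    have hψ : DifferentiableOn ℂ (fun t : ℂ => g (inner ℂ v z • v
        + ((r : ℂ) * t) • (z - inner ℂ v z • v))) (ball 0 1) := by
      refine hg.comp (by fun_prop) fun t ht => ?_
      rw [mem_ball_zero_iff] at ht ⊢
      have h1 := norm_sq_proj_add hv (inner ℂ v z) ((r : ℂ) * t) z
      have h2 := norm_sq_proj_add hv (inner ℂ v z) 1 z
      rw [one_smul, add_sub_cancel, norm_one] at h2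
      have h3 : ‖(r : ℂ) * t‖ ≤ r := by
        rw [norm_mul, Complex.norm_real, Real.norm_eq_abs, abs_of_pos hr]
        nlinarith
      have h4 : ‖(r : ℂ) * t‖ ^ 2 ≤ r ^ 2 := by gcongr
      have h5 : ‖inner ℂ v z • v + ((r : ℂ) * t) • (z - inner ℂ v z • v)‖ ^ 2 ≤ (r * ‖z‖) ^ 2 := by
        nlinarith [mul_le_mul_of_nonneg_right h4 (sq_nonneg ‖z - inner ℂ v z • v‖),
          mul_nonneg (sq_nonneg ‖inner ℂ v z‖) (by nlinarith : (0 : ℝ) ≤ r ^ 2 - 1)]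
      exact ((sq_le_sq₀ (norm_nonneg _) (by positivity)).1 h5).trans_lt hr1
    obtain ⟨p', hp', -, hmean'⟩ := exists_series_norm_le_circle_mean hψ
    have hτ : ‖((r⁻¹ : ℝ) : ℂ)‖ < 1 := by
      rw [Complex.norm_real, Real.norm_eq_abs, abs_of_pos (by positivity)]
      exact inv_lt_one_of_one_lt₀ hr0
    have h0 : ‖p' 0‖ = ‖g (inner ℂ v z • v)‖ := by
      rw [← ContinuousMultilinearMap.fin0_apply_norm (p' 0) (x := fun _ => 0), hp'.coeff_zero]
      simp
    have h1 := hmean' 0 _ hτ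
    rw [pow_zero, mul_one, h0] at h1
    have h2 := ofReal_mul_le_lintegral_circle hψ hτ (k := ‖inner ℂ v z‖ ^ j) (by positivity) h1
    have hrr : ∀ c : ℂ, (r : ℂ) * (c * ((r⁻¹ : ℝ) : ℂ)) = c := fun c => by
      have : (r : ℂ) ≠ 0 := by exact_mod_cast hr.ne'
      push_cast; field_simp
    simpa only [hrr] using h2
  have hline : ∫⁻ z in ball (0 : V) 1,
        ENNReal.ofReal (‖p j‖ * ‖inner ℂ v z‖ ^ j * ‖inner ℂ v z‖ ^ j)
      ≤ ∫⁻ z in ball (0 : V) 1, ENNReal.ofReal (‖g (inner ℂ v z • v)‖ * ‖inner ℂ v z‖ ^ j) := by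
    refine setLIntegral_le_of_le_average rotateAll
      (by simp only [rotateAll_apply]; fun_prop) hcont' fun z hz => ?_
    have h2 := ofReal_mul_le_lintegral_circle hφ (hinner z hz) (k := ‖inner ℂ v z‖ ^ j)
      (by positivity) (hmean j _ (hinner z hz))
    simpa [inner_smul_right, Complex.norm_exp_ofReal_mul_I] using h2
  have hle : ∀ z ∈ ball (0 : V) 1, ‖inner ℂ v z‖ ^ j ≤ 1 := fun z hz =>
    pow_le_one₀ (norm_nonneg _) (hinner z hz).le
  have hint1 : IntegrableOn (fun z : V => ‖g z‖ * ‖inner ℂ v z‖ ^ j) (ball 0 1) := by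
    have hdom : IntegrableOn (fun z : V => ‖g z‖ ^ 2 + 1) (ball 0 1) :=
      hint.add (integrableOn_const measure_ball_lt_top.ne)
    refine Integrable.mono' hdom (hcont.aestronglyMeasurable measurableSet_ball) ?_
    refine (ae_restrict_iff' measurableSet_ball).2 (Filter.Eventually.of_forall fun z hz => ?_)
    rw [Real.norm_eq_abs, abs_of_nonneg (by positivity)]
    nlinarith [hle z hz, norm_nonneg (g z), sq_nonneg (‖g z‖ - 1)]
  have hint2 : IntegrableOn (fun z : V => ‖p j‖ * ‖inner ℂ v z‖ ^ j * ‖inner ℂ v z‖ ^ j)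
      (ball 0 1) := by
    simp only [mul_assoc, ← pow_add]
    exact (inner_sq_integrableOn v (j + j)).const_mul ‖p j‖
  have hreal := hline.trans horth
  rw [← ofReal_integral_eq_lintegral_ofReal hint1 (Filter.Eventually.of_forall fun z => by
      positivity), ← ofReal_integral_eq_lintegral_ofReal hint2
      (Filter.Eventually.of_forall fun z => by positivity),
    ENNReal.ofReal_le_ofReal_iff (integral_nonneg fun z => by positivity)] at hreal
  have hamgm : 2 * ‖p j‖ * ∫ z in ball (0 : V) 1, ‖g z‖ * ‖inner ℂ v z‖ ^ j
      ≤ (∫ z in ball (0 : V) 1, ‖g z‖ ^ 2)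
        + ‖p j‖ * ∫ z in ball (0 : V) 1, ‖p j‖ * ‖inner ℂ v z‖ ^ j * ‖inner ℂ v z‖ ^ j := by
    rw [← integral_const_mul, ← integral_const_mul, ← integral_add hint (hint2.const_mul _)]
    refine integral_mono (hint1.const_mul _) (hint.add (hint2.const_mul _)) fun z => ?_
    change _ ≤ ‖g z‖ ^ 2 + _
    nlinarith [sq_nonneg (‖g z‖ - ‖p j‖ * ‖inner ℂ v z‖ ^ j)]
  have hmom : ∫ z in ball (0 : V) 1, ‖p j‖ * ‖inner ℂ v z‖ ^ j * ‖inner ℂ v z‖ ^ j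
      = ‖p j‖ * ∫ z in ball (0 : V) 1, (‖inner ℂ v z‖ ^ 2) ^ j := by
    rw [← integral_const_mul]
    congr 1; ext z; ring
  have hlow := moment_lower_bound hv j
  have hN : (0 : ℝ) < Module.finrank ℂ V + 1 := by positivity
  rw [one_div, inv_pow, inv_mul_le_iff₀ (by positivity)] at hlow
  rw [hmom] at hreal hamgm
  have h1 : ‖p j‖ ^ 2 * ∫ z in ball (0 : V) 1, (‖inner ℂ v z‖ ^ 2) ^ j
      ≤ ∫ z in ball (0 : V) 1, ‖g z‖ ^ 2 := by
    nlinarith [mul_le_mul_of_nonneg_left hreal (norm_nonneg (p j))]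
  calc ‖p j‖ ^ 2 * volume.real (ball (0 : V) 1)
      ≤ ‖p j‖ ^ 2 * ((Module.finrank ℂ V + 1) ^ j
          * ∫ z in ball (0 : V) 1, (‖inner ℂ v z‖ ^ 2) ^ j) := by gcongr
    _ = (Module.finrank ℂ V + 1) ^ j
          * (‖p j‖ ^ 2 * ∫ z in ball (0 : V) 1, (‖inner ℂ v z‖ ^ 2) ^ j) := by ring
    _ ≤ _ := by gcongr

end Slices

section Taylor

variable {V W : Type*} [NormedAddCommGroup V] [InnerProductSpace ℂ V] [InnerProductSpace ℝ V]
  [IsScalarTower ℝ ℂ V] [FiniteDimensional ℝ V] [FiniteDimensional ℂ V] [MeasurableSpace V]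
  [BorelSpace V] [NormedAddCommGroup W] [NormedSpace ℂ W] [CompleteSpace W]

/-- Size of the slice coefficients of a square integrable holomorphic map. -/
theorem exists_slice_series_norm_le {g : V → W} (hg : DifferentiableOn ℂ g (ball 0 1))
    (hint : IntegrableOn (fun z => ‖g z‖ ^ 2) (ball 0 1)) {M : ℝ} (hM : 0 ≤ M)
    (hgM : ∫ z in ball (0 : V) 1, ‖g z‖ ^ 2 ≤ M ^ 2 * volume.real (ball (0 : V) 1))
    {v : V} (hv : ‖v‖ = 1) :
    ∃ p : FormalMultilinearSeries ℂ ℂ W,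
      (∀ t : ℂ, ‖t‖ < 1 → HasSum (fun j => p j fun _ => t) (g (t • v))) ∧
      (p 0 fun _ => (0 : ℂ)) = g 0 ∧ (∀ t : ℂ, (p 1 fun _ => t) = t • fderiv ℂ g 0 v) ∧
      ∀ j, ‖p j‖ ≤ √(Module.finrank ℂ V + 1) ^ j * M := by
  obtain ⟨p, hp, hsum, hb⟩ := exists_slice_series hg hint hv
  refine ⟨p, hsum, ?_, ?_, fun j => ?_⟩
  · simpa using hp.coeff_zero (fun _ => (0 : ℂ))
  · have h0 : HasFDerivAt g (fderiv ℂ g 0) ((0 : ℂ) • v) := by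
      rw [zero_smul]
      exact (hg.differentiableAt (ball_mem_nhds 0 one_pos)).hasFDerivAt
    have h1 : HasDerivAt (fun t : ℂ => t • v) v 0 := by
      simpa using (hasDerivAt_id (0 : ℂ)).smul_const v
    have h2 := (h0.comp_hasDerivAt (0 : ℂ) h1).deriv
    have h3 := hp.deriv
    intro t
    have h4 : (p 1 fun _ => t) = t • p 1 fun _ => 1 := by
      simp
    rw [h4, ← h3]
    exact congrArg _ h2
  · have hvol : 0 < volume.real (ball (0 : V) 1) :=
      ENNReal.toReal_pos (measure_ball_pos _ _ one_pos).ne' measure_ball_lt_top.ne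
    refine le_of_sq_le_sq ?_ (by positivity)
    have h1 := (hb j).trans (mul_le_mul_of_nonneg_left hgM (by positivity))
    rw [← mul_assoc] at h1
    have h2 := le_of_mul_le_mul_right h1 hvol
    calc ‖p j‖ ^ 2 ≤ (Module.finrank ℂ V + 1) ^ j * M ^ 2 := h2
      _ = _ := by
        rw [mul_pow, ← pow_mul, mul_comm j 2, pow_mul, Real.sq_sqrt (by positivity)]

theorem norm_fderiv_zero_le {g : V → W} (hg : DifferentiableOn ℂ g (ball 0 1))
    (hint : IntegrableOn (fun z => ‖g z‖ ^ 2) (ball 0 1)) {M : ℝ} (hM : 0 ≤ M)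
    (hgM : ∫ z in ball (0 : V) 1, ‖g z‖ ^ 2 ≤ M ^ 2 * volume.real (ball (0 : V) 1))
    (v : V) : ‖fderiv ℂ g 0 v‖ ≤ √(Module.finrank ℂ V + 1) * M * ‖v‖ := by
  rcases eq_or_ne v 0 with rfl | hv0
  · simp
  have hv : ‖((‖v‖ : ℂ)⁻¹) • v‖ = 1 := by
    rw [norm_smul, norm_inv, Complex.norm_real, norm_norm, inv_mul_cancel₀ (norm_ne_zero_iff.2 hv0)]
  obtain ⟨p, -, -, h1, hb⟩ := exists_slice_series_norm_le hg hint hM hgM hv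
  have h2 := h1 (‖v‖ : ℂ)
  rw [← map_smul, smul_smul, mul_inv_cancel₀ (by simpa using hv0), one_smul] at h2
  rw [← h2]
  have h3 := (p 1).le_opNorm (fun _ => (‖v‖ : ℂ))
  simp only [Finset.univ_unique, Finset.prod_const, Finset.card_singleton, pow_one,
    Complex.norm_real, norm_norm] at h3
  exact h3.trans (mul_le_mul_of_nonneg_right (by simpa using hb 1) (norm_nonneg _))

/-- Second order Taylor remainder at the centre of the unit ball. -/
theorem norm_sub_fderiv_zero_le {g : V → W} (hg : DifferentiableOn ℂ g (ball 0 1))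
    (hint : IntegrableOn (fun z => ‖g z‖ ^ 2) (ball 0 1)) {M : ℝ} (hM : 0 ≤ M)
    (hgM : ∫ z in ball (0 : V) 1, ‖g z‖ ^ 2 ≤ M ^ 2 * volume.real (ball (0 : V) 1))
    (hg0 : g 0 = 0) {y : V} (hy : √(Module.finrank ℂ V + 1) * ‖y‖ < 1) :
    ‖g y - fderiv ℂ g 0 y‖ ≤
      M * (Module.finrank ℂ V + 1) * ‖y‖ ^ 2 / (1 - √(Module.finrank ℂ V + 1) * ‖y‖) := by
  rcases eq_or_ne y 0 with rfl | hy0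
  · simp [hg0]
  set N : ℝ := Module.finrank ℂ V + 1 with hN
  have hN1 : 1 ≤ √N := Real.one_le_sqrt.2 (by simp [hN])
  have hN0 : 0 ≤ N := by positivity
  have hv : ‖((‖y‖ : ℂ)⁻¹) • y‖ = 1 := by
    rw [norm_smul, norm_inv, Complex.norm_real, norm_norm, inv_mul_cancel₀ (norm_ne_zero_iff.2 hy0)]
  obtain ⟨p, hsum, h0, h1, hb⟩ := exists_slice_series_norm_le hg hint hM hgM hv
  have hyC : (‖y‖ : ℂ) • ((‖y‖ : ℂ)⁻¹) • y = y := by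
    rw [smul_smul, mul_inv_cancel₀ (by simpa using hy0), one_smul]
  have hs := hsum (‖y‖ : ℂ) (by
    rw [Complex.norm_real, norm_norm]; nlinarith [norm_nonneg y])
  rw [hyC] at hs
  have h1' := h1 (‖y‖ : ℂ)
  rw [← map_smul, hyC] at h1'
  have h0' : (p 0 fun _ => (‖y‖ : ℂ)) = 0 := by
    rw [show (fun _ : Fin 0 => (‖y‖ : ℂ)) = fun _ => 0 from Subsingleton.elim _ _, h0, hg0]
  have hs2 := (hasSum_nat_add_iff' 2).2 hs
  simp only [Finset.sum_range_succ, Finset.sum_range_zero, h0', h1', zero_add] at hs2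
  have hgeo := ((hasSum_geometric_of_lt_one (by positivity) hy).mul_left (M * N * ‖y‖ ^ 2))
  rw [div_eq_mul_inv, ← hs2.tsum_eq]
  refine tsum_of_norm_bounded hgeo fun j => ?_
  refine ((p (j + 2)).le_opNorm _).trans ?_
  simp only [Finset.prod_const, Finset.card_univ, Fintype.card_fin, Complex.norm_real, norm_norm]
  calc ‖p (j + 2)‖ * ‖y‖ ^ (j + 2) ≤ √N ^ (j + 2) * M * ‖y‖ ^ (j + 2) := by gcongr; exact hb _
    _ = M * √N ^ 2 * ‖y‖ ^ 2 * (√N * ‖y‖) ^ j := by ring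
    _ = _ := by rw [Real.sq_sqrt hN0]

end Taylor

section BallShift

variable {V : Type*} [NormedAddCommGroup V] [InnerProductSpace ℂ V]

/-- `id + f(·) v` as a continuous linear map. -/
def idAddRankOne (f : V →L[ℂ] ℂ) (v : V) : V →L[ℂ] V := .id ℂ V + f.smulRight v

@[simp] theorem idAddRankOne_apply (f : V →L[ℂ] ℂ) (v w : V) :
    idAddRankOne f v w = w + f w • v := rfl

theorem det_idAddRankOne [FiniteDimensional ℂ V] (f : V →L[ℂ] ℂ) (v : V) :
    (idAddRankOne f v).det = 1 + f v := by
  rw [← ContinuousLinearMap.coe_coe f, ← LinearMap.transvection.det]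
  rfl

/-- The map `w ↦ w - ⟪a, w⟫ a / (1 + σ)`; when `σ ^ 2 = 1 - ‖a‖ ^ 2` it shrinks the direction of
`a` by the factor `σ` and fixes its orthogonal complement. -/
def shrink (σ : ℝ) (a : V) : V →L[ℂ] V :=
  idAddRankOne (-((1 + σ : ℝ)⁻¹ : ℂ) • innerSL ℂ a) a

/-- The map `w ↦ σ w + ⟪a, w⟫ a / (1 + σ)`, which is `σ` times the inverse of `shrink σ a`. -/
def coshrink (σ : ℝ) (a : V) : V →L[ℂ] V :=
  (σ : ℂ) • .id ℂ V + (((1 + σ : ℝ)⁻¹ : ℂ) • innerSL ℂ a).smulRight a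

theorem shrink_apply (σ : ℝ) (a w : V) :
    shrink σ a w = w - (((1 + σ : ℝ)⁻¹ : ℂ) * inner ℂ a w) • a := by
  simp [shrink, sub_eq_add_neg]

theorem coshrink_apply (σ : ℝ) (a w : V) :
    coshrink σ a w = (σ : ℂ) • w + (((1 + σ : ℝ)⁻¹ : ℂ) * inner ℂ a w) • a := by
  simp [coshrink]

variable {σ : ℝ} {a : V}

theorem inner_self_eq_of_sq (h : σ ^ 2 = 1 - ‖a‖ ^ 2) :
    inner ℂ a a = (1 - (σ : ℂ) ^ 2) := by
  rw [inner_self_eq_norm_sq_to_K]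
  have h1 : ‖a‖ ^ 2 = 1 - σ ^ 2 := by linarith
  have h2 := congrArg (fun r : ℝ => (r : ℂ)) h1
  push_cast at h2
  exact h2

theorem inner_shrink (hσ : 0 < σ) (h : σ ^ 2 = 1 - ‖a‖ ^ 2) (w : V) :
    inner ℂ a (shrink σ a w) = σ * inner ℂ a w := by
  have : (1 + σ : ℂ) ≠ 0 := by exact_mod_cast (by positivity : (1 + σ) ≠ 0)
  rw [shrink_apply, inner_sub_right, inner_smul_right, inner_self_eq_of_sq h]
  push_cast
  field_simp
  ring

theorem inner_coshrink (hσ : 0 < σ) (h : σ ^ 2 = 1 - ‖a‖ ^ 2) (w : V) :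
    inner ℂ a (coshrink σ a w) = inner ℂ a w := by
  have : (1 + σ : ℂ) ≠ 0 := by exact_mod_cast (by positivity : (1 + σ) ≠ 0)
  rw [coshrink_apply, inner_add_right, inner_smul_right, inner_smul_right, inner_self_eq_of_sq h]
  push_cast
  field_simp
  ring

theorem coshrink_shrink (hσ : 0 < σ) (h : σ ^ 2 = 1 - ‖a‖ ^ 2) (w : V) :
    coshrink σ a (shrink σ a w) = (σ : ℂ) • w := by
  rw [coshrink_apply, inner_shrink hσ h, shrink_apply]
  module

theorem shrink_coshrink (hσ : 0 < σ) (h : σ ^ 2 = 1 - ‖a‖ ^ 2) (w : V) :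
    shrink σ a (coshrink σ a w) = (σ : ℂ) • w := by
  rw [shrink_apply, inner_coshrink hσ h, coshrink_apply]
  module

theorem det_shrink [FiniteDimensional ℂ V] (hσ : 0 < σ) (h : σ ^ 2 = 1 - ‖a‖ ^ 2) :
    (shrink σ a).det = σ := by
  have : (1 + σ : ℂ) ≠ 0 := by exact_mod_cast (by positivity : (1 + σ) ≠ 0)
  rw [shrink, det_idAddRankOne]
  simp only [smul_apply, innerSL_apply_apply, inner_self_eq_of_sq h,
    smul_eq_mul]
  push_cast
  field_simp
  ring

theorem norm_smul_add_smul_sq (α β : ℂ) (y : V) :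
    ‖α • a + β • y‖ ^ 2 = Complex.normSq α * ‖a‖ ^ 2
      + 2 * (star α * β * inner ℂ a y).re + Complex.normSq β * ‖y‖ ^ 2 := by
  rw [norm_add_sq (𝕜 := ℂ), inner_smul_left, inner_smul_right, norm_smul, norm_smul, mul_pow,
    mul_pow, Complex.sq_norm, Complex.sq_norm, mul_assoc]
  rfl

theorem norm_coshrink_le (hσ : 0 < σ) (h : σ ^ 2 = 1 - ‖a‖ ^ 2) (w : V) :
    ‖coshrink σ a w‖ ≤ ‖w‖ := by
  refine le_of_sq_le_sq ?_ (norm_nonneg _)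
  have ha : ‖a‖ ^ 2 = 1 - σ ^ 2 := by linarith
  have hc : Complex.normSq (inner ℂ a w) ≤ (1 - σ ^ 2) * ‖w‖ ^ 2 := by
    rw [← Complex.sq_norm, ← ha, ← mul_pow]
    gcongr
    exact norm_inner_le_norm a w
  rw [coshrink_apply, add_comm, norm_smul_add_smul_sq, ha]
  refine le_trans (le_of_eq ?_) (sub_nonneg.1 (by linarith :
    0 ≤ ‖w‖ ^ 2 - (Complex.normSq (inner ℂ a w) + σ ^ 2 * ‖w‖ ^ 2)))
  obtain ⟨p, q⟩ := inner ℂ a w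
  simp [Complex.normSq_apply]
  norm_cast
  field_simp
  ring

/-- The defect of the norm from `1` under the ball automorphism moving the origin to `a`. -/
theorem norm_shift_sq (hσ : 0 < σ) (h : σ ^ 2 = 1 - ‖a‖ ^ 2) (y : V) :
    ‖(1 + inner ℂ a y) • a + (σ : ℂ) • shrink σ a y‖ ^ 2
      = ‖1 + inner ℂ a y‖ ^ 2 - σ ^ 2 * (1 - ‖y‖ ^ 2) := by
  have ha : ‖a‖ ^ 2 = 1 - σ ^ 2 := by linarith
  have h1 : (1 + inner ℂ a y) • a + (σ : ℂ) • shrink σ a y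
      = (1 + ((1 + σ : ℝ)⁻¹ : ℂ) * inner ℂ a y) • a + (σ : ℂ) • y := by
    have : (1 + σ : ℂ) ≠ 0 := by exact_mod_cast (by positivity : (1 + σ) ≠ 0)
    rw [shrink_apply]
    match_scalars
    · field_simp; ring
    · simp
  rw [h1, norm_smul_add_smul_sq, ha, Complex.sq_norm]
  obtain ⟨p, q⟩ := inner ℂ a y
  simp [Complex.normSq_apply]
  norm_cast
  field_simp
  ring

end BallShift

section Transplant

variable {V W : Type*} [NormedAddCommGroup V] [InnerProductSpace ℂ V]
  [NormedAddCommGroup W] [NormedSpace ℂ W]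

/-- The biholomorphic map from the unit ball to `ball ω R` (when `σ ^ 2 = 1 - ‖a‖ ^ 2`) sending the
origin to `ω + R a`. -/
def ballMap (σ : ℝ) (a ω : V) (R : ℝ) (y : V) : V :=
  ω + (R : ℂ) • a + ((σ * R : ℂ) * (1 + inner ℂ a y)⁻¹) • shrink σ a y

variable {σ R : ℝ} {a ω : V}

theorem one_add_inner_ne_zero (ha : ‖a‖ ≤ 1) {y : V} (hy : ‖y‖ < 1) :
    1 + inner ℂ a y ≠ 0 := fun h => by
  have h1 : ‖inner ℂ a y‖ < 1 :=
    (norm_inner_le_norm a y).trans_lt (by nlinarith [norm_nonneg a, norm_nonneg y])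
  rw [← neg_eq_of_add_eq_zero_right h] at h1
  simp at h1

theorem ballMap_mem (hσ : 0 < σ) (h : σ ^ 2 = 1 - ‖a‖ ^ 2) (hR : 0 < R) {y : V} (hy : ‖y‖ < 1) :
    ballMap σ a ω R y ∈ ball ω R := by
  have hD : 1 + inner ℂ a y ≠ 0 := one_add_inner_ne_zero (by nlinarith [norm_nonneg a]) hy
  have hD' : 0 < ‖1 + inner ℂ a y‖ := norm_pos_iff.2 hD
  have h1 : ballMap σ a ω R y - ω =
      ((R : ℂ) * (1 + inner ℂ a y)⁻¹) • ((1 + inner ℂ a y) • a + (σ : ℂ) • shrink σ a y) := by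
    rw [ballMap]
    match_scalars <;> field_simp
    ring
  have h2 : ‖(1 + inner ℂ a y) • a + (σ : ℂ) • shrink σ a y‖ < ‖1 + inner ℂ a y‖ := by
    refine lt_of_pow_lt_pow_left₀ 2 hD'.le ?_
    rw [norm_shift_sq hσ h]
    have : 0 < σ ^ 2 * (1 - ‖y‖ ^ 2) := by
      have := norm_nonneg y
      have : 0 < 1 - ‖y‖ ^ 2 := by nlinarith
      positivity
    linarith
  rw [mem_ball_iff_norm, h1, norm_smul, norm_mul, norm_inv, Complex.norm_real, Real.norm_eq_abs,
    abs_of_pos hR, mul_assoc]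
  calc _ < R * (‖1 + inner ℂ a y‖⁻¹ * ‖1 + inner ℂ a y‖) := by gcongr
    _ = R := by rw [inv_mul_cancel₀ hD'.ne', mul_one]

theorem ballMap_injOn (hσ : 0 < σ) (h : σ ^ 2 = 1 - ‖a‖ ^ 2) (hR : 0 < R) :
    Set.InjOn (ballMap σ a ω R) (ball 0 1) := by
  intro y hy y' hy' hyy
  rw [mem_ball_zero_iff] at hy hy'
  have ha : ‖a‖ ≤ 1 := by nlinarith [norm_nonneg a]
  have hD := one_add_inner_ne_zero ha hy
  have hD' := one_add_inner_ne_zero ha hy'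
  have hσ' : (σ : ℂ) ≠ 0 := by exact_mod_cast hσ.ne'
  have hR' : (R : ℂ) ≠ 0 := by exact_mod_cast hR.ne'
  have h1 := congrArg (coshrink σ a) (add_left_cancel hyy)
  rw [map_smul, map_smul, coshrink_shrink hσ h, coshrink_shrink hσ h, mul_smul (σ * R : ℂ),
    mul_smul (σ * R : ℂ)] at h1
  have h2 := smul_right_injective V (mul_ne_zero hσ' hR') h1
  rw [smul_comm _ (σ : ℂ), smul_comm _ (σ : ℂ)] at h2
  have h3 := smul_right_injective V hσ' h2
  have h4 := congrArg (inner ℂ a) h3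
  simp only [inner_smul_right] at h4
  have h5 : inner ℂ a y = inner ℂ a y' := by
    field_simp at h4
    linear_combination h4
  rw [← h5] at h3
  exact smul_right_injective V (inv_ne_zero hD) h3

theorem hasFDerivAt_ballMap (ω : V) (σ R : ℝ) {y : V} (hD : 1 + inner ℂ a y ≠ 0) :
    HasFDerivAt (ballMap σ a ω R) (((σ * R : ℂ) * (1 + inner ℂ a y)⁻¹) •
      (shrink σ a).comp (idAddRankOne (-(1 + inner ℂ a y)⁻¹ • innerSL ℂ a) y)) y := by
  have h1 : HasFDerivAt (fun y : V => 1 + inner ℂ a y) (innerSL ℂ a) y :=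
    ((innerSL ℂ a).hasFDerivAt).const_add 1
  have h2 := ((hasFDerivAt_inv hD).comp y h1).const_mul (σ * R : ℂ)
  have h3 := (h2.fun_smul (shrink σ a).hasFDerivAt).const_add (ω + (R : ℂ) • a)
  refine h3.congr_fderiv ?_
  ext w
  simp only [Function.comp_apply, add_apply, smul_apply,
    ContinuousLinearMap.smulRight_apply, ContinuousLinearMap.comp_apply, innerSL_apply_apply,
    ContinuousLinearMap.toSpanSingleton_apply, idAddRankOne_apply, map_add, map_smul, smul_eq_mul,
    ← inv_pow]
  module

variable [FiniteDimensional ℂ V]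

theorem det_ballMap (hσ : 0 < σ) (h : σ ^ 2 = 1 - ‖a‖ ^ 2) {y : V} (hD : 1 + inner ℂ a y ≠ 0) :
    (((σ * R : ℂ) * (1 + inner ℂ a y)⁻¹) •
      (shrink σ a).comp (idAddRankOne (-(1 + inner ℂ a y)⁻¹ • innerSL ℂ a) y)).det
    = ((σ * R : ℂ) * (1 + inner ℂ a y)⁻¹) ^ Module.finrank ℂ V * (σ * (1 + inner ℂ a y)⁻¹) := by
  have h1 := det_shrink hσ h
  have h2 := det_idAddRankOne (-(1 + inner ℂ a y)⁻¹ • innerSL ℂ a) y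
  rw [ContinuousLinearMap.det] at h1 h2 ⊢
  rw [ContinuousLinearMap.toLinearMap_smul, LinearMap.det_smul, ContinuousLinearMap.toLinearMap_comp,
    LinearMap.det_comp, h1, h2]
  congr 2
  simp
  field_simp
  ring

variable [InnerProductSpace ℝ V] [IsScalarTower ℝ ℂ V] [FiniteDimensional ℝ V]
  [MeasurableSpace V] [BorelSpace V]

theorem det_restrictScalars_real (T : V →L[ℂ] V) :
    (T.restrictScalars ℝ).det = ‖T.det‖ ^ 2 := by
  rw [Complex.sq_norm, ← Algebra.norm_complex_apply, ContinuousLinearMap.det,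
    ← LinearMap.det_restrictScalars]
  rfl

/-- Weighted composition with `ballMap` transplants square integrable holomorphic maps on a ball to
the unit ball. -/
theorem exists_transplant {f : V → W} (hf : DifferentiableOn ℂ f (ball ω R))
    (hint : IntegrableOn (fun z => ‖f z‖ ^ 2) (ball ω R)) (hσ : 0 < σ)
    (h : σ ^ 2 = 1 - ‖a‖ ^ 2) (hR : 0 < R) :
    ∃ g : V → W, DifferentiableOn ℂ g (ball 0 1) ∧
      IntegrableOn (fun z => ‖g z‖ ^ 2) (ball 0 1) ∧
      R ^ (2 * Module.finrank ℂ V) * σ ^ (2 * (Module.finrank ℂ V + 1)) *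
        ∫ z in ball (0 : V) 1, ‖g z‖ ^ 2 ≤ ∫ z in ball ω R, ‖f z‖ ^ 2 ∧
      g 0 = f (ω + (R : ℂ) • a) ∧
      ∀ η : V, ‖η‖ < ‖1 - inner ℂ a η‖ →
        f (ω + (R : ℂ) • a + (σ ^ 2 * R : ℂ) • η) =
          ((1 - inner ℂ a η)⁻¹ ^ (Module.finrank ℂ V + 1)) •
            g ((1 - inner ℂ a η)⁻¹ • coshrink σ a η) := by
  set m := Module.finrank ℂ V with hm
  have ha : ‖a‖ ≤ 1 := by nlinarith [norm_nonneg a]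
  let g : V → W := fun y => ((1 + inner ℂ a y)⁻¹ ^ (m + 1)) • f (ballMap σ a ω R y)
  have hD : ∀ y ∈ ball (0 : V) 1, 1 + inner ℂ a y ≠ 0 := fun y hy =>
    one_add_inner_ne_zero ha (mem_ball_zero_iff.1 hy)
  have hder : ∀ y ∈ ball (0 : V) 1, HasFDerivWithinAt (ballMap σ a ω R)
      ((((σ * R : ℂ) * (1 + inner ℂ a y)⁻¹) • (shrink σ a).comp
        (idAddRankOne (-(1 + inner ℂ a y)⁻¹ • innerSL ℂ a) y)).restrictScalars ℝ)
      (ball 0 1) y := fun y hy =>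
    ((hasFDerivAt_ballMap ω σ R (hD y hy)).restrictScalars ℝ).hasFDerivWithinAt
  have hmaps : Set.MapsTo (ballMap σ a ω R) (ball 0 1) (ball ω R) := fun y hy =>
    ballMap_mem hσ h hR (mem_ball_zero_iff.1 hy)
  have hinj := ballMap_injOn (ω := ω) hσ h hR
  have hint' := hint.mono_set hmaps.image_subset
  rw [integrableOn_image_iff_integrableOn_abs_det_fderiv_smul volume measurableSet_ball hder hinj]
    at hint'
  have hcv := integral_image_eq_integral_abs_det_fderiv_smul volume measurableSet_ball hder hinj
    (fun z => ‖f z‖ ^ 2)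
  have hk : 0 < R ^ (2 * m) * σ ^ (2 * (m + 1)) := by positivity
  have hpt : Set.EqOn (fun y => |((((σ * R : ℂ) * (1 + inner ℂ a y)⁻¹) • (shrink σ a).comp
        (idAddRankOne (-(1 + inner ℂ a y)⁻¹ • innerSL ℂ a) y)).restrictScalars ℝ).det| •
          ‖f (ballMap σ a ω R y)‖ ^ 2)
      (fun y => (R ^ (2 * m) * σ ^ (2 * (m + 1))) * ‖g y‖ ^ 2) (ball 0 1) := fun y hy => by
    simp only [g]
    rw [det_restrictScalars_real, det_ballMap hσ h (hD y hy), norm_smul, abs_of_nonneg (by positivity),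
      norm_mul, norm_mul, norm_pow, norm_pow, norm_mul, norm_mul, Complex.norm_real,
      Complex.norm_real, Real.norm_of_nonneg hσ.le, Real.norm_of_nonneg hR.le, smul_eq_mul, ← hm]
    ring
  rw [integrableOn_congr_fun hpt measurableSet_ball] at hint'
  rw [setIntegral_congr_fun measurableSet_ball hpt, integral_const_mul] at hcv
  refine ⟨g, ?_, ?_, ?_, ?_, ?_⟩
  · intro y hy
    have h1 : DifferentiableAt ℂ (ballMap σ a ω R) y :=
      (hasFDerivAt_ballMap ω σ R (hD y hy)).differentiableAt
    have h2 : DifferentiableAt ℂ f (ballMap σ a ω R y) :=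
      hf.differentiableAt (isOpen_ball.mem_nhds (hmaps hy))
    have h3 : DifferentiableAt ℂ (fun y : V => 1 + inner ℂ a y) y :=
      (((innerSL ℂ a).hasFDerivAt).const_add 1).differentiableAt
    exact (((h3.inv (hD y hy)).pow (m + 1)).smul (h2.comp y h1)).differentiableWithinAt
  · have := hint'.const_mul (R ^ (2 * m) * σ ^ (2 * (m + 1)))⁻¹
    simp only [inv_mul_cancel_left₀ hk.ne'] at this
    exact this
  · rw [← hcv]
    exact setIntegral_mono_set hint (Filter.Eventually.of_forall fun z => by positivity)
      (Filter.Eventually.of_forall hmaps.image_subset)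
  · simp [g, ballMap]
  · intro η hη
    have hd : 1 - inner ℂ a η ≠ 0 := norm_pos_iff.1 ((norm_nonneg _).trans_lt hη)
    have h1 : 1 + inner ℂ a ((1 - inner ℂ a η)⁻¹ • coshrink σ a η) = (1 - inner ℂ a η)⁻¹ := by
      rw [inner_smul_right, inner_coshrink hσ h]
      field_simp
      ring
    have hσ' : (σ : ℂ) ≠ 0 := by exact_mod_cast hσ.ne'
    simp only [g, ballMap]
    rw [h1, inv_inv, smul_smul, ← mul_pow, inv_mul_cancel₀ hd, one_pow, one_smul, map_smul,
      shrink_coshrink hσ h, smul_smul, smul_smul]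
    congr 3
    field_simp

end Transplant

section Expansion

variable {V W : Type*} [NormedAddCommGroup V] [InnerProductSpace ℂ V]
  [NormedAddCommGroup W] [NormedSpace ℂ W]

/-- A map that vanishes to second order has a small derivative nearby; the constant comes from the
parallelogram law. -/
theorem norm_fderiv_le_of_norm_le_sq {F : V → W} {r C : ℝ}
    (hF : DifferentiableOn ℂ F (ball 0 r)) {h : V} (hh : 2 * ‖h‖ < r) (h0 : 0 < ‖h‖) (hC : 0 ≤ C)
    (hb : ∀ η : V, ‖η‖ ≤ 2 * ‖h‖ → ‖F η‖ ≤ C * ‖η‖ ^ 2) :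
    ‖fderiv ℂ F h‖ ≤ 2 * C * ‖h‖ := by
  refine ContinuousLinearMap.opNorm_le_bound _ (by positivity) fun w => ?_
  rcases eq_or_ne w 0 with rfl | hw0
  · simp
  have hw : 0 < ‖w‖ := norm_pos_iff.2 hw0
  set ρ : ℝ := ‖h‖ / ‖w‖ with hρ
  have hρ0 : 0 < ρ := by positivity
  have hρw : ρ * ‖w‖ = ‖h‖ := by rw [hρ]; field_simp
  have htw : ∀ t ∈ closedBall (0 : ℂ) ρ, ‖t • w‖ ≤ ‖h‖ := fun t ht => by
    rw [norm_smul, ← hρw]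
    exact mul_le_mul_of_nonneg_right (mem_closedBall_zero_iff.1 ht) hw.le
  have hdiff : ∀ ε : ℂ, ‖ε‖ = 1 → ∀ t ∈ closedBall (0 : ℂ) ρ,
      DifferentiableAt ℂ (fun t : ℂ => F (h + ε • t • w)) t := fun ε hε t ht => by
    have h1 : DifferentiableAt ℂ F (h + ε • t • w) := by
      refine hF.differentiableAt (isOpen_ball.mem_nhds (mem_ball_zero_iff.2 ?_))
      have h2 := norm_add_le h (ε • t • w)
      rw [norm_smul ε, hε, one_mul] at h2
      linarith [htw t ht]
    exact h1.comp t (by fun_prop)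
  have hderiv : ∀ ε : ℂ, HasDerivAt (fun t : ℂ => F (h + ε • t • w)) (ε • fderiv ℂ F h w) 0 := by
    intro ε
    have h1 : HasFDerivAt F (fderiv ℂ F h) (h + ε • (0 : ℂ) • w) := by
      rw [zero_smul, smul_zero, add_zero]
      exact (hF.differentiableAt (isOpen_ball.mem_nhds
        (mem_ball_zero_iff.2 (by linarith)))).hasFDerivAt
    have h2 : HasDerivAt (fun t : ℂ => h + ε • t • w) (ε • w) 0 := by
      simpa using (((hasDerivAt_id (0 : ℂ)).smul_const w).const_smul ε).const_add h
    simpa [Function.comp_def] using h1.comp_hasDerivAt (0 : ℂ) h2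
  have key := Complex.norm_deriv_le_of_forall_mem_sphere_norm_le
    (f := fun t : ℂ => F (h + (1 : ℂ) • t • w) - F (h + (-1 : ℂ) • t • w)) (c := 0) (R := ρ)
    (C := 4 * C * ‖h‖ ^ 2) hρ0 ?_ ?_
  · rw [((hderiv 1).fun_sub (hderiv (-1))).deriv, one_smul, neg_one_smul, sub_neg_eq_add, ← two_smul ℂ,
      norm_smul, RCLike.norm_ofNat, hρ] at key
    have : 4 * C * ‖h‖ ^ 2 / (‖h‖ / ‖w‖) = 4 * C * ‖h‖ * ‖w‖ := by field_simp
    linarith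
  · have hd : DifferentiableOn ℂ
        (fun t : ℂ => F (h + (1 : ℂ) • t • w) - F (h + (-1 : ℂ) • t • w)) (closedBall 0 ρ) :=
      fun t ht => ((hdiff 1 (by simp) t ht).sub (hdiff (-1) (by simp) t ht)).differentiableWithinAt
    exact (hd.mono closure_ball_subset_closedBall).diffContOnCl
  · intro t ht
    have htn : ‖t • w‖ = ‖h‖ := by
      rw [norm_smul, mem_sphere_zero_iff_norm.1 ht, hρw]
    have h1 := hb (h + (1 : ℂ) • t • w) (by
      have := norm_add_le h ((1 : ℂ) • t • w)
      rw [one_smul] at this ⊢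
      linarith)
    have h2 := hb (h + (-1 : ℂ) • t • w) (by
      have := norm_add_le h ((-1 : ℂ) • t • w)
      rw [neg_one_smul, norm_neg] at this
      rw [neg_one_smul]
      linarith)
    have h3 := parallelogram_law_with_norm ℂ h (t • w)
    rw [htn] at h3
    rw [one_smul] at h1
    rw [neg_one_smul, ← sub_eq_add_neg] at h2
    refine (norm_sub_le _ _).trans ?_
    rw [one_smul, neg_one_smul, ← sub_eq_add_neg]
    nlinarith

theorem norm_pow_sub_one_le {x : ℂ} {X : ℝ} (h1 : ‖x - 1‖ ≤ X - 1) (k : ℕ) :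
    ‖x ^ k - 1‖ ≤ X ^ k - 1 := by
  have hX : 1 ≤ X := by linarith [norm_nonneg (x - 1)]
  have hx : ‖x‖ ≤ X := by
    have := norm_add_le (x - 1) 1
    rw [sub_add_cancel, norm_one] at this
    linarith
  induction k with
  | zero => simp
  | succ k ih =>
    calc ‖x ^ (k + 1) - 1‖ = ‖x * (x ^ k - 1) + (x - 1)‖ := by ring_nf
      _ ≤ X * (X ^ k - 1) + (X - 1) := by
        refine (norm_add_le _ _).trans (add_le_add ?_ h1)
        rw [norm_mul]
        gcongr
      _ = X ^ (k + 1) - 1 := by ring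

theorem one_sub_le_norm_one_sub_inner (a η : V) : 1 - ‖a‖ * ‖η‖ ≤ ‖1 - inner ℂ a η‖ := by
  have h1 := norm_sub_norm_le 1 (inner ℂ a η)
  rw [norm_one] at h1
  linarith [norm_inner_le_norm (𝕜 := ℂ) a η]

theorem hasFDerivAt_kernel_smul (a : V) (k : ℕ) {h : V} (hd : 1 - inner ℂ a h ≠ 0) :
    HasFDerivAt (fun η : V => ((1 - inner ℂ a η)⁻¹ ^ k) • η)
      (((1 - inner ℂ a h)⁻¹ ^ k) • .id ℂ V +
        ((k * (1 - inner ℂ a h)⁻¹ ^ (k + 1) : ℂ) • innerSL ℂ a).smulRight h) h := by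
  have h1 : HasFDerivAt (fun y : V => 1 - inner ℂ a y) (-innerSL ℂ a) h :=
    ((innerSL ℂ a).hasFDerivAt).const_sub 1
  have h2 := ((hasFDerivAt_inv hd).comp h h1).pow k
  refine (h2.fun_smul (hasFDerivAt_id h)).congr_fderiv ?_
  ext w
  rcases k with _ | k
  · simp
  simp only [Function.comp_apply, add_apply, smul_apply, neg_apply,
    ContinuousLinearMap.smulRight_apply, ContinuousLinearMap.comp_apply, innerSL_apply_apply,
    ContinuousLinearMap.toSpanSingleton_apply, smul_eq_mul,
    ← inv_pow, ContinuousLinearMap.coe_id', id, Nat.add_sub_cancel, nsmul_eq_mul]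
  module

/-- How far the derivative of `η ↦ η / (1 - ⟪a, η⟫) ^ k` is from the identity. -/
theorem norm_kernel_deriv_sub_id_le (a h : V) (k : ℕ) (hah : ‖a‖ * ‖h‖ < 1) :
    ‖((1 - inner ℂ a h)⁻¹ ^ k) • ContinuousLinearMap.id ℂ V +
        ((k * (1 - inner ℂ a h)⁻¹ ^ (k + 1) : ℂ) • innerSL ℂ a).smulRight h - .id ℂ V‖ ≤
      (1 - ‖a‖ * ‖h‖)⁻¹ ^ k - 1 + k * (‖a‖ * ‖h‖) * (1 - ‖a‖ * ‖h‖)⁻¹ ^ (k + 1) := by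
  have hδ : 0 < 1 - ‖a‖ * ‖h‖ := by linarith
  have hd := one_sub_le_norm_one_sub_inner a h
  have hd0 : 1 - inner ℂ a h ≠ 0 := norm_pos_iff.1 (hδ.trans_le hd)
  have hinv : ‖(1 - inner ℂ a h)⁻¹‖ ≤ (1 - ‖a‖ * ‖h‖)⁻¹ := by
    rw [norm_inv]
    gcongr
  have hsub : ‖(1 - inner ℂ a h)⁻¹ - 1‖ ≤ (1 - ‖a‖ * ‖h‖)⁻¹ - 1 := by
    have h1 : (1 - inner ℂ a h)⁻¹ - 1 = inner ℂ a h * (1 - inner ℂ a h)⁻¹ := by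
      field_simp
      ring
    have h2 : (1 - ‖a‖ * ‖h‖)⁻¹ - 1 = (‖a‖ * ‖h‖) * (1 - ‖a‖ * ‖h‖)⁻¹ := by
      field_simp
      ring
    rw [h1, h2, norm_mul]
    gcongr
    exact norm_inner_le_norm a h
  have hsplit : ((1 - inner ℂ a h)⁻¹ ^ k) • ContinuousLinearMap.id ℂ V - .id ℂ V
      = ((1 - inner ℂ a h)⁻¹ ^ k - 1) • ContinuousLinearMap.id ℂ V := by module
  rw [add_sub_right_comm, hsplit]
  refine (norm_add_le _ _).trans (add_le_add ?_ ?_)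
  · rw [norm_smul]
    exact (mul_le_of_le_one_right (norm_nonneg _) ContinuousLinearMap.norm_id_le).trans
      (norm_pow_sub_one_le hsub k)
  · rw [ContinuousLinearMap.norm_smulRight_apply, norm_smul, innerSL_apply_norm, norm_mul, norm_pow,
      Complex.norm_natCast]
    calc k * ‖(1 - inner ℂ a h)⁻¹‖ ^ (k + 1) * ‖a‖ * ‖h‖
        ≤ k * (1 - ‖a‖ * ‖h‖)⁻¹ ^ (k + 1) * ‖a‖ * ‖h‖ := by gcongr
      _ = _ := by ring

end Expansion

section DerivativeBounds

variable {V W : Type*} [NormedAddCommGroup V] [InnerProductSpace ℂ V] [InnerProductSpace ℝ V]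
  [IsScalarTower ℝ ℂ V] [FiniteDimensional ℝ V] [FiniteDimensional ℂ V]
  [MeasurableSpace V] [BorelSpace V]
  [NormedAddCommGroup W] [NormedSpace ℂ W] [CompleteSpace W]

variable {σ R : ℝ} {a ω : V}

theorem shift_mem_ball (h : σ ^ 2 = 1 - ‖a‖ ^ 2) (ha : ‖a‖ < 1) (hR : 0 < R) {η : V}
    (hη : (‖a‖ + 1) * ‖η‖ < 1) : ω + (R : ℂ) • a + (σ ^ 2 * R : ℂ) • η ∈ ball ω R := by
  rw [mem_ball_iff_norm, add_assoc, add_sub_cancel_left]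
  have h1 : ‖(σ ^ 2 * R : ℂ)‖ = σ ^ 2 * R := by
    rw [← Complex.ofReal_pow, ← Complex.ofReal_mul, Complex.norm_real,
      Real.norm_of_nonneg (by positivity)]
  refine (norm_add_le _ _).trans_lt ?_
  rw [norm_smul, norm_smul, h1, Complex.norm_real, Real.norm_of_nonneg hR.le, h]
  have h2 : (1 - ‖a‖) * ((‖a‖ + 1) * ‖η‖) < (1 - ‖a‖) * 1 :=
    mul_lt_mul_of_pos_left hη (by linarith)
  nlinarith

/-- Expansion of a square integrable holomorphic map around a zero in the ball, with the kernel
factor that makes the remainder uniformly small. -/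
theorem kernel_expansion {f : V → W} (hf : DifferentiableOn ℂ f (ball ω R))
    (hint : IntegrableOn (fun z => ‖f z‖ ^ 2) (ball ω R)) (hσ : 0 < σ)
    (h : σ ^ 2 = 1 - ‖a‖ ^ 2) (hR : 0 < R) {M : ℝ} (hM : 0 ≤ M)
    (hfM : ∫ z in ball ω R, ‖f z‖ ^ 2 ≤ R ^ (2 * Module.finrank ℂ V) *
      σ ^ (2 * (Module.finrank ℂ V + 1)) * (M ^ 2 * volume.real (ball (0 : V) 1)))
    (h0 : f (ω + (R : ℂ) • a) = 0) :
    (∀ v : V, σ ^ 2 * R * ‖fderiv ℂ f (ω + (R : ℂ) • a) v‖ ≤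
      √(Module.finrank ℂ V + 1) * M * ‖coshrink σ a v‖) ∧
    ∀ η : V, (‖a‖ + √(Module.finrank ℂ V + 1)) * ‖η‖ < 1 →
      ‖f (ω + (R : ℂ) • a + (σ ^ 2 * R : ℂ) • η) -
        (σ ^ 2 * R : ℂ) • fderiv ℂ f (ω + (R : ℂ) • a)
          (((1 - inner ℂ a η)⁻¹ ^ (Module.finrank ℂ V + 2)) • η)‖ ≤
      M * (Module.finrank ℂ V + 1) * ‖η‖ ^ 2 * (1 - ‖a‖ * ‖η‖)⁻¹ ^ (Module.finrank ℂ V + 2) /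
        (1 - (‖a‖ + √(Module.finrank ℂ V + 1)) * ‖η‖) := by
  obtain ⟨g, hg, hgint, hgle, hg0, hgf⟩ := exists_transplant hf hint hσ h hR
  set m := Module.finrank ℂ V with hm
  set N : ℝ := (m : ℝ) + 1 with hN
  have hN1 : 1 ≤ √N := Real.one_le_sqrt.2 (by simp [hN])
  have ha : ‖a‖ < 1 := by nlinarith [norm_nonneg a, pow_pos hσ 2]
  have hgM : ∫ z in ball (0 : V) 1, ‖g z‖ ^ 2 ≤ M ^ 2 * volume.real (ball (0 : V) 1) :=
    le_of_mul_le_mul_left (hgle.trans hfM) (by positivity)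
  have hg00 : g 0 = 0 := hg0.trans h0
  have hsmall : ∀ η : V, (‖a‖ + √N) * ‖η‖ < 1 →
      0 < 1 - ‖a‖ * ‖η‖ ∧ √N * ‖η‖ < 1 - ‖a‖ * ‖η‖ ∧ ‖η‖ ≤ √N * ‖η‖ ∧
        1 - ‖a‖ * ‖η‖ ≤ ‖1 - inner ℂ a η‖ := fun η hη => by
    have h1 : ‖η‖ ≤ √N * ‖η‖ := le_mul_of_one_le_left (norm_nonneg _) hN1
    refine ⟨?_, ?_, h1, one_sub_le_norm_one_sub_inner a η⟩ <;> nlinarith [norm_nonneg η]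
  have hexp : ∀ η : V, (‖a‖ + √N) * ‖η‖ < 1 →
      ‖f (ω + (R : ℂ) • a + (σ ^ 2 * R : ℂ) • η) - fderiv ℂ g 0 (coshrink σ a
          (((1 - inner ℂ a η)⁻¹ ^ (m + 2)) • η))‖ ≤
      M * N * ‖η‖ ^ 2 * (1 - ‖a‖ * ‖η‖)⁻¹ ^ (m + 2) / (1 - (‖a‖ + √N) * ‖η‖) := by
    intro η hη
    obtain ⟨hδ, hδ', hη', hd⟩ := hsmall η hη
    set δ := 1 - ‖a‖ * ‖η‖ with hδdef
    have hinv : ‖(1 - inner ℂ a η)⁻¹‖ ≤ δ⁻¹ := by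
      rw [norm_inv]
      gcongr
    set y := (1 - inner ℂ a η)⁻¹ • coshrink σ a η with hy
    have hyn : ‖y‖ ≤ δ⁻¹ * ‖η‖ := by
      rw [hy, norm_smul]
      have := norm_coshrink_le hσ h η
      gcongr
    have hNy : √N * (δ⁻¹ * ‖η‖) < 1 := by
      rw [mul_left_comm, inv_mul_lt_iff₀ hδ, mul_one]
      exact hδ'
    have hNy' : √N * ‖y‖ ≤ √N * (δ⁻¹ * ‖η‖) := by gcongr
    have hT := norm_sub_fderiv_zero_le hg hgint hM hgM hg00 (hNy'.trans_lt hNy)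
    rw [← hm, ← hN] at hT
    rw [hgf η (by linarith)]
    have hlin : fderiv ℂ g 0 (coshrink σ a (((1 - inner ℂ a η)⁻¹ ^ (m + 2)) • η))
        = ((1 - inner ℂ a η)⁻¹ ^ (m + 1)) • fderiv ℂ g 0 y := by
      rw [hy, map_smul, map_smul, map_smul, smul_smul, ← pow_succ]
    rw [hlin, ← smul_sub, norm_smul, norm_pow]
    calc ‖(1 - inner ℂ a η)⁻¹‖ ^ (m + 1) * ‖g y - fderiv ℂ g 0 y‖
        ≤ δ⁻¹ ^ (m + 1) * (M * N * (δ⁻¹ * ‖η‖) ^ 2 / (1 - √N * (δ⁻¹ * ‖η‖))) := by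
          refine mul_le_mul (by gcongr) (hT.trans ?_) (norm_nonneg _) (by positivity)
          have : 0 < 1 - √N * (δ⁻¹ * ‖η‖) := by linarith
          gcongr
      _ = M * N * ‖η‖ ^ 2 * δ⁻¹ ^ (m + 2) / (1 - (‖a‖ + √N) * ‖η‖) := by
        have h1 : 1 - (‖a‖ + √N) * ‖η‖ = δ - √N * ‖η‖ := by rw [hδdef]; ring
        have h2 : 1 - √N * (δ⁻¹ * ‖η‖) = δ⁻¹ * (δ - √N * ‖η‖) := by field_simp
        have h3 : δ - √N * ‖η‖ ≠ 0 := by linarith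
        rw [h1, h2, show δ⁻¹ ^ (m + 2) = δ⁻¹ ^ (m + 1) * δ⁻¹ from pow_succ _ _]
        field_simp
  have hc : (σ ^ 2 * R : ℂ) ≠ 0 := by exact_mod_cast (by positivity : σ ^ 2 * R ≠ 0)
  have hfder : HasFDerivAt (fun η : V => f (ω + (R : ℂ) • a + (σ ^ 2 * R : ℂ) • η))
      ((σ ^ 2 * R : ℂ) • fderiv ℂ f (ω + (R : ℂ) • a)) 0 := by
    have h1 : HasFDerivAt f (fderiv ℂ f (ω + (R : ℂ) • a))
        (ω + (R : ℂ) • a + (σ ^ 2 * R : ℂ) • (0 : V)) := by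
      have := shift_mem_ball (ω := ω) h ha hR (η := 0) (by simp)
      have h2 := (hf.differentiableAt (isOpen_ball.mem_nhds this)).hasFDerivAt
      rwa [smul_zero, add_zero] at h2 ⊢
    refine (h1.comp (0 : V) (((hasFDerivAt_id (0 : V)).const_smul
      (σ ^ 2 * R : ℂ)).const_add (ω + (R : ℂ) • a))).congr_fderiv ?_
    ext w
    simp
  have hkder := hasFDerivAt_kernel_smul a (m + 2) (h := 0) (by simp)
  have hGder := (fderiv ℂ g 0 ∘L coshrink σ a).hasFDerivAt.comp (0 : V) hkder
  have hrem : HasFDerivAt (fun η : V => f (ω + (R : ℂ) • a + (σ ^ 2 * R : ℂ) • η) -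
      fderiv ℂ g 0 (coshrink σ a (((1 - inner ℂ a η)⁻¹ ^ (m + 2)) • η))) (0 : V →L[ℂ] W) 0 := by
    refine Asymptotics.IsBigO.hasFDerivAt (n := 2) ?_ one_lt_two
    let b : V → ℝ := fun η => M * N * (1 - ‖a‖ * ‖η‖)⁻¹ ^ (m + 2) / (1 - (‖a‖ + √N) * ‖η‖)
    have hb : ContinuousAt b 0 := by
      refine ContinuousAt.div ?_ (by fun_prop) (by simp)
      exact continuousAt_const.mul (((by fun_prop : ContinuousAt (fun η : V => 1 - ‖a‖ * ‖η‖) 0).inv₀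
        (by simp)).pow _)
    have hb1 := hb.eventually_le_const (show b 0 < b 0 + 1 by linarith)
    have hb2 : ∀ᶠ η : V in nhds 0, (‖a‖ + √N) * ‖η‖ < 1 :=
      (by fun_prop : ContinuousAt (fun η : V => (‖a‖ + √N) * ‖η‖) 0).eventually_lt_const (by simp)
    refine Asymptotics.IsBigO.of_bound (b 0 + 1) ?_
    filter_upwards [hb1, hb2] with η h1 h2
    rw [sub_zero, norm_pow, norm_norm]
    calc _ ≤ _ := hexp η h2
      _ = b η * ‖η‖ ^ 2 := by simp only [b]; ring
      _ ≤ _ := by gcongr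
  have hG : fderiv ℂ g 0 ∘L coshrink σ a = (σ ^ 2 * R : ℂ) • fderiv ℂ f (ω + (R : ℂ) • a) := by
    have h1 := (hfder.sub hGder).unique hrem
    rw [sub_eq_zero] at h1
    rw [h1]
    ext w
    simp
  have hGv : ∀ v, fderiv ℂ g 0 (coshrink σ a v)
      = (σ ^ 2 * R : ℂ) • fderiv ℂ f (ω + (R : ℂ) • a) v := fun v =>
    congrArg (fun T : V →L[ℂ] W => T v) hG
  refine ⟨fun v => ?_, fun η hη => ?_⟩
  · have h1 := norm_fderiv_zero_le hg hgint hM hgM (coshrink σ a v)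
    rw [hGv, norm_smul, ← Complex.ofReal_pow, ← Complex.ofReal_mul, Complex.norm_real,
      Real.norm_of_nonneg (by positivity)] at h1
    exact h1
  · rw [← hGv]
    exact hexp η hη

/-- Distance from the identity of `Df(ζ)⁻¹ Df(x)`. -/
theorem norm_symm_comp_fderiv_sub_id_le {f : V → W} (hf : DifferentiableOn ℂ f (ball ω R))
    (hint : IntegrableOn (fun z => ‖f z‖ ^ 2) (ball ω R)) (hσ : 0 < σ)
    (h : σ ^ 2 = 1 - ‖a‖ ^ 2) (hR : 0 < R) {M : ℝ} (hM : 0 ≤ M)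
    (hfM : ∫ z in ball ω R, ‖f z‖ ^ 2 ≤ R ^ (2 * Module.finrank ℂ V) *
      σ ^ (2 * (Module.finrank ℂ V + 1)) * (M ^ 2 * volume.real (ball (0 : V) 1)))
    (h0 : f (ω + (R : ℂ) • a) = 0) (A : V ≃L[ℂ] W)
    (hA : (A : V →L[ℂ] W) = fderiv ℂ f (ω + (R : ℂ) • a)) {η : V} (hη0 : 0 < ‖η‖)
    (hη : (‖a‖ + √(Module.finrank ℂ V + 1)) * (2 * ‖η‖) < 1) :
    ‖(A.symm : W →L[ℂ] V) ∘L fderiv ℂ f (ω + (R : ℂ) • a + (σ ^ 2 * R : ℂ) • η) - .id ℂ V‖ ≤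
      (1 - ‖a‖ * ‖η‖)⁻¹ ^ (Module.finrank ℂ V + 2) - 1 +
      (Module.finrank ℂ V + 2) * (‖a‖ * ‖η‖) * (1 - ‖a‖ * ‖η‖)⁻¹ ^ (Module.finrank ℂ V + 3) +
      2 * (‖(A.symm : W →L[ℂ] V)‖ * M / (σ ^ 2 * R)) * (Module.finrank ℂ V + 1) * ‖η‖ *
        (1 - ‖a‖ * (2 * ‖η‖))⁻¹ ^ (Module.finrank ℂ V + 2) /
        (1 - (‖a‖ + √(Module.finrank ℂ V + 1)) * (2 * ‖η‖)) := by
  obtain ⟨-, hexp⟩ := kernel_expansion hf hint hσ h hR hM hfM h0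
  set m := Module.finrank ℂ V with hm
  set N : ℝ := (m : ℝ) + 1 with hN
  set c : ℂ := σ ^ 2 * R with hcdef
  have hcn : ‖c‖ = σ ^ 2 * R := by
    rw [hcdef, ← Complex.ofReal_pow, ← Complex.ofReal_mul, Complex.norm_real,
      Real.norm_of_nonneg (by positivity)]
  have hc0 : 0 < σ ^ 2 * R := by positivity
  have hc : c ≠ 0 := norm_pos_iff.1 (hcn ▸ hc0)
  have hN1 : 1 ≤ √N := Real.one_le_sqrt.2 (by simp [hN])
  have ha : ‖a‖ < 1 := by nlinarith [norm_nonneg a, pow_pos hσ 2]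
  have hνN : 0 < ‖a‖ + √N := by linarith [norm_nonneg a]
  set r : ℝ := (‖a‖ + √N)⁻¹ with hr
  have hball : ∀ y ∈ ball (0 : V) r, (‖a‖ + √N) * ‖y‖ < 1 := fun y hy => by
    rw [mem_ball_zero_iff] at hy
    calc (‖a‖ + √N) * ‖y‖ < (‖a‖ + √N) * r := by gcongr
      _ = 1 := mul_inv_cancel₀ hνN.ne'
  have hdiffpt : ∀ y : V, (‖a‖ + √N) * ‖y‖ < 1 → HasFDerivAt
      (fun η : V => f (ω + (R : ℂ) • a + c • η) - c • A (((1 - inner ℂ a η)⁻¹ ^ (m + 2)) • η))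
      (c • fderiv ℂ f (ω + (R : ℂ) • a + c • y) - c • (A : V →L[ℂ] W) ∘L
        (((1 - inner ℂ a y)⁻¹ ^ (m + 2)) • .id ℂ V +
        (((m + 2 : ℕ) * (1 - inner ℂ a y)⁻¹ ^ (m + 2 + 1) : ℂ) • innerSL ℂ a).smulRight y)) y := by
    intro y hy
    have hy1 : (‖a‖ + 1) * ‖y‖ < 1 := lt_of_le_of_lt (by gcongr) hy
    have hd : 1 - inner ℂ a y ≠ 0 := norm_pos_iff.1 (lt_of_lt_of_le
      (by nlinarith [norm_nonneg y]) (one_sub_le_norm_one_sub_inner a y))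
    have h1 := (hf.differentiableAt
      (isOpen_ball.mem_nhds (shift_mem_ball (ω := ω) h ha hR hy1))).hasFDerivAt
    have h2 := h1.comp y (((hasFDerivAt_id y).const_smul c).const_add (ω + (R : ℂ) • a))
    have h3 := ((c • (A : V →L[ℂ] W)).hasFDerivAt).comp y (hasFDerivAt_kernel_smul a (m + 2) hd)
    refine (h2.sub h3).congr_fderiv ?_
    ext w
    simp only [ContinuousLinearMap.comp_smul, ContinuousLinearMap.comp_id,
      ContinuousLinearMap.smul_comp, sub_apply, smul_apply]
    rfl
  have hFd : fderiv ℂ _ η = _ := (hdiffpt η (by nlinarith)).fderiv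
  have hF := norm_fderiv_le_of_norm_le_sq
    (F := fun η : V => f (ω + (R : ℂ) • a + c • η) - c • A (((1 - inner ℂ a η)⁻¹ ^ (m + 2)) • η))
    (r := r) (h := η) (C := M * N * (1 - ‖a‖ * (2 * ‖η‖))⁻¹ ^ (m + 2) /
      (1 - (‖a‖ + √N) * (2 * ‖η‖)))
    (fun y hy => (hdiffpt y (hball y hy)).differentiableAt.differentiableWithinAt)
    ?_ hη0 ?_ ?_
  · rw [hFd] at hF
    set K : V →L[ℂ] V := ((1 - inner ℂ a η)⁻¹ ^ (m + 2)) • .id ℂ V +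
      (((m + 2 : ℕ) * (1 - inner ℂ a η)⁻¹ ^ (m + 2 + 1) : ℂ) • innerSL ℂ a).smulRight η with hK
    have hsplit : (A.symm : W →L[ℂ] V) ∘L fderiv ℂ f (ω + (R : ℂ) • a + c • η) - .id ℂ V =
        c⁻¹ • ((A.symm : W →L[ℂ] V) ∘L (c • fderiv ℂ f (ω + (R : ℂ) • a + c • η)
          - c • (A : V →L[ℂ] W) ∘L K)) + (K - .id ℂ V) := by
      ext w
      simp only [ContinuousLinearMap.comp_apply, ContinuousLinearEquiv.coe_coe, add_apply, sub_apply,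
        smul_apply, map_sub, map_smul, ContinuousLinearEquiv.symm_apply_apply,
        ContinuousLinearMap.id_apply]
      rw [← smul_sub, inv_smul_smul₀ hc]
      abel
    have hKn := norm_kernel_deriv_sub_id_le a η (m + 2) (by nlinarith)
    rw [hsplit, add_comm]
    refine (norm_add_le _ _).trans (add_le_add ?_ ?_)
    · exact_mod_cast hKn
    · rw [norm_smul, norm_inv, hcn]
      refine (mul_le_mul_of_nonneg_left ((ContinuousLinearMap.opNorm_comp_le _ _).trans
        (mul_le_mul_of_nonneg_left hF (norm_nonneg _))) (by positivity)).trans (le_of_eq ?_)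
      ring
  · rw [hr, ← one_div, lt_div_iff₀ hνN]
    linarith
  · have : 0 < 1 - ‖a‖ * (2 * ‖η‖) := by nlinarith
    have : 0 < 1 - (‖a‖ + √N) * (2 * ‖η‖) := by linarith
    positivity
  · intro y hy
    have hy1 : (‖a‖ + √N) * ‖y‖ < 1 := lt_of_le_of_lt (by gcongr) hη
    have h1 := hexp y hy1
    rw [← hA] at h1
    refine h1.trans ?_
    have h2 : 0 < 1 - ‖a‖ * (2 * ‖η‖) := by nlinarith
    have h3 : 0 < 1 - (‖a‖ + √N) * (2 * ‖η‖) := by linarith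
    have h4 : ‖a‖ * ‖y‖ ≤ ‖a‖ * (2 * ‖η‖) := by gcongr
    have h5 : 0 < 1 - ‖a‖ * ‖y‖ := by linarith
    calc M * N * ‖y‖ ^ 2 * (1 - ‖a‖ * ‖y‖)⁻¹ ^ (m + 2) / (1 - (‖a‖ + √N) * ‖y‖)
        ≤ M * N * ‖y‖ ^ 2 * (1 - ‖a‖ * (2 * ‖η‖))⁻¹ ^ (m + 2) /
          (1 - (‖a‖ + √N) * (2 * ‖η‖)) := by gcongr
      _ = _ := by ring

end DerivativeBounds

section Estimates

theorem scalar_bound_of_le {w u c d : ℝ} (hwc : w ≤ c) (hud : u ≤ d)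
    (hc : 0 < 1 - 8 / 3 * c) (hcd : 0 < 1 - (2 / 3 * c + 1.155 * d)) :
    0.77 / (1 - 5 / 3 * w) + 2 / 3 / ((1 - 8 / 3 * w) * (1 - (2 / 3 * w + 1.155 * u))) ≤
      0.77 / (1 - 5 / 3 * c) + 2 / 3 / ((1 - 8 / 3 * c) * (1 - (2 / 3 * c + 1.155 * d))) := by
  have : 0 < 1 - 5 / 3 * c := by linarith
  have : 0 < 1 - 8 / 3 * w := by linarith
  gcongr

theorem scalar_bound {w u : ℝ} (hu : 0 ≤ u) (hwu : w ≤ u)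
    (h : 3 * (2 * u + 3 * u ^ 2) ^ 2 ≤ 1) (hw : w ^ 2 ≤ u ^ 2 * (1 - 3 * (2 * u + 3 * u ^ 2) ^ 2)) :
    0 < 1 - 8 / 3 * w ∧ 0 < 1 - (2 / 3 * w + 1.155 * u) ∧
    0.77 / (1 - 5 / 3 * w) + 2 / 3 / ((1 - 8 / 3 * w) * (1 - (2 / 3 * w + 1.155 * u))) ≤
      (2 - u) / (1 - u) ^ 2 := by
  have hu2 : u ≤ 0.2177 := by
    by_contra! hlt
    nlinarith [pow_lt_pow_left₀ hlt (by norm_num) two_ne_zero]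
  have hw2 : w ≤ 0.118 := by
    refine le_of_sq_le_sq (hw.trans ?_) (by norm_num)
    nlinarith [mul_nonneg hu (sq_nonneg (u - 0.158)), sq_nonneg (u ^ 2 - 0.025),
      mul_nonneg (pow_nonneg hu 3) (sq_nonneg (u - 0.158)),
      mul_nonneg (pow_nonneg hu 2) (sq_nonneg (u - 0.158)), sq_nonneg (u - 0.158),
      mul_nonneg (pow_nonneg hu 4) (sq_nonneg (u - 0.158))]
  refine ⟨by linarith, by linarith, ?_⟩
  have h1u : 0 < (1 - u) ^ 2 := by nlinarith
  rcases le_total u 0.09 with h1 | h1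
  · refine (scalar_bound_of_le (hwu.trans h1) h1 (by norm_num) (by norm_num)).trans ?_
    refine le_trans (b := 2) (by norm_num) ?_
    rw [le_div_iff₀ h1u]
    nlinarith
  rcases le_total u 0.12 with h2 | h2
  · refine (scalar_bound_of_le hw2 h2 (by norm_num) (by norm_num)).trans ?_
    refine le_trans (b := 2.3) (by norm_num) ?_
    rw [le_div_iff₀ h1u]
    nlinarith
  · refine (scalar_bound_of_le hw2 hu2 (by norm_num) (by norm_num)).trans ?_
    refine le_trans (b := 2.42) (by norm_num) ?_
    rw [le_div_iff₀ h1u]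
    nlinarith

theorem inv_sq_sub_one {u : ℝ} (hu : u < 1) :
    (1 - u)⁻¹ ^ 2 - 1 = u * (2 - u) / (1 - u) ^ 2 := by
  have : 1 - u ≠ 0 := by linarith
  field_simp
  ring

theorem inv_pow_sub_one_le {x : ℝ} (hx : 0 ≤ x) (hx1 : x < 1) (k : ℕ) :
    (1 - x)⁻¹ ^ k - 1 ≤ k * x * (1 - x)⁻¹ ^ (k + 1) := by
  have h0 : 0 < 1 - x := by linarith
  have h1 : 1 + (k : ℝ) * -x ≤ (1 + -x) ^ k := one_add_mul_le_pow (by linarith) k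
  rw [← sub_eq_add_neg] at h1
  have h2 : 1 ≤ (1 - x)⁻¹ := (one_le_inv₀ h0).2 (by linarith)
  have h3 : (1 - x)⁻¹ ^ k - 1 = (1 - (1 - x) ^ k) * (1 - x)⁻¹ ^ k := by
    rw [sub_mul, ← mul_pow, mul_inv_cancel₀ h0.ne', one_pow, one_mul]
  rw [h3]
  calc (1 - (1 - x) ^ k) * (1 - x)⁻¹ ^ k ≤ (k * x) * (1 - x)⁻¹ ^ k := by
        gcongr
        linarith
    _ ≤ _ := by
        gcongr
        exact Nat.le_succ k

theorem inv_pow_le_inv {x y : ℝ} (k : ℕ) (hx1 : x ≤ 1) (hy : k * x ≤ y) (hy1 : 0 < 1 - y) :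
    (1 - x)⁻¹ ^ k ≤ (1 - y)⁻¹ := by
  have h1 : 1 + (k : ℝ) * -x ≤ (1 + -x) ^ k := one_add_mul_le_pow (by linarith) k
  rw [← sub_eq_add_neg] at h1
  rw [inv_pow]
  gcongr
  linarith

theorem three_mul_sq_le {N ν X u : ℝ} (hN3 : 3 ≤ N) (hs : 0 < 1 - ν ^ 2) (hX : 0 < X)
    (hXN : 1 ≤ X ^ 2 * (N * (1 - ν ^ 2))) (hu0 : 0 ≤ u) (hu1 : u < 1)
    (h : N * X * (u * (2 - u) / (1 - u) ^ 2) ≤ 1) :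
    3 * (2 * u + 3 * u ^ 2) ^ 2 ≤ 1 - ν ^ 2 := by
  have h1u : 0 < 1 - u := by linarith
  have hN0 : 0 < N := by linarith
  have hlow : 2 * u + 3 * u ^ 2 ≤ u * (2 - u) / (1 - u) ^ 2 := by
    rw [le_div_iff₀ (by positivity)]
    nlinarith [pow_nonneg hu0 3, mul_nonneg (pow_nonneg hu0 3) h1u.le]
  have hlow2 : N * X * (2 * u + 3 * u ^ 2) ≤ 1 :=
    (mul_le_mul_of_nonneg_left hlow (by positivity)).trans h
  have h1 : (N * X * (2 * u + 3 * u ^ 2)) ^ 2 ≤ 1 := pow_le_one₀ (by positivity) hlow2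
  have h2 : (N * (2 * u + 3 * u ^ 2) ^ 2) * 1 ≤
      (N * (2 * u + 3 * u ^ 2) ^ 2) * (X ^ 2 * (N * (1 - ν ^ 2))) := by gcongr
  have h3 : (1 - ν ^ 2) * (N * X * (2 * u + 3 * u ^ 2)) ^ 2 ≤ (1 - ν ^ 2) * 1 := by gcongr
  have h4 : 3 * (2 * u + 3 * u ^ 2) ^ 2 ≤ N * (2 * u + 3 * u ^ 2) ^ 2 := by gcongr
  linarith

theorem two_mul_le_mul_sqrt {N ν X : ℝ} (hN0 : 0 ≤ N) (hX : 0 ≤ X)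
    (hXN : 1 ≤ X ^ 2 * (N * (1 - ν ^ 2))) : 2 * ν ≤ X * √N := by
  refine le_of_sq_le_sq ?_ (by positivity)
  rw [mul_pow, mul_pow, Real.sq_sqrt hN0]
  have h1 : ν ^ 2 * 1 ≤ ν ^ 2 * (X ^ 2 * (N * (1 - ν ^ 2))) := by gcongr
  have h2 : X ^ 2 * N * (4 * (ν ^ 2 * (1 - ν ^ 2))) ≤ X ^ 2 * N * 1 := by
    gcongr
    linarith [sq_nonneg (2 * ν ^ 2 - 1)]
  linarith

/-- The scalar inequality comparing the sharp derivative estimate with the target bound. -/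
theorem derivative_bound_le {N : ℕ} (hN : 3 ≤ N) {ν q X : ℝ} (hν : 0 ≤ ν) (hν1 : ν < 1)
    (hq : 0 ≤ q) (hX : 0 < X) (hXN : 1 ≤ X ^ 2 * (N * (1 - ν ^ 2))) (hu : N * q < 1)
    (h : N * X * ((1 - N * q)⁻¹ ^ 2 - 1) ≤ 1) :
    (ν + √N) * (2 * q) < 1 ∧
    (1 - ν * q)⁻¹ ^ (N + 1) - 1 + (N + 1) * (ν * q) * (1 - ν * q)⁻¹ ^ (N + 2) +
      2 * X * N * q * (1 - ν * (2 * q))⁻¹ ^ (N + 1) / (1 - (ν + √N) * (2 * q)) ≤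
    N * X * ((1 - N * q)⁻¹ ^ 2 - 1) := by
  have hN3 : (3 : ℝ) ≤ N := by exact_mod_cast hN
  have hN0 : (0 : ℝ) < N := by linarith
  have hs : 0 < 1 - ν ^ 2 := by nlinarith
  have hsN0 : 0 < √(N : ℝ) := Real.sqrt_pos.2 hN0
  set u : ℝ := N * q with hudef
  have hu0 : 0 ≤ u := by positivity
  have h1u : 0 < 1 - u := by linarith
  rw [inv_sq_sub_one hu] at h ⊢
  have hsq := three_mul_sq_le hN3 hs hX hXN hu0 hu h
  set w : ℝ := ν * u with hwdef
  have hw0 : 0 ≤ w := by positivity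
  have hwu : w ≤ u := mul_le_of_le_one_left hu0 hν1.le
  have hw2 : w ^ 2 ≤ u ^ 2 * (1 - 3 * (2 * u + 3 * u ^ 2) ^ 2) := by
    rw [hwdef, mul_pow, mul_comm]
    gcongr
    linarith
  obtain ⟨hd1, hd2, hmain⟩ := scalar_bound hu0 hwu (by nlinarith) hw2
  have hd3 : 0 < 1 - 5 / 3 * w := by linarith
  have hνq0 : 0 ≤ ν * q := by positivity
  have hNνq : N * (ν * q) = w := by rw [hwdef, hudef]; ring
  have hνq3 : 3 * (ν * q) ≤ w := by rw [← hNνq]; gcongr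
  have hsqrt3 : √(N : ℝ) ≤ 0.5775 * N := by
    refine Real.sqrt_le_iff.2 ⟨by positivity, ?_⟩
    nlinarith
  have hden : (ν + √N) * (2 * q) ≤ 2 / 3 * w + 1.155 * u := by
    have h1 : √N * q ≤ 0.5775 * u := by rw [hudef, ← mul_assoc]; gcongr
    linarith
  have hνX := two_mul_le_mul_sqrt hN0.le hX.le hXN
  have hfirst : (1 - ν * q)⁻¹ ^ (N + 1) - 1 + (N + 1) * (ν * q) * (1 - ν * q)⁻¹ ^ (N + 2) ≤
      N ^ 2 * X * q * (0.77 / (1 - 5 / 3 * w)) := by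
    have h1 := inv_pow_sub_one_le (mul_nonneg hν hq) (by linarith : ν * q < 1) (N + 1)
    have h2 : (1 - ν * q)⁻¹ ^ (N + 2) ≤ (1 - 5 / 3 * w)⁻¹ := by
      refine inv_pow_le_inv _ (by linarith) ?_ hd3
      push_cast
      linarith
    have h3 : (N + 1) * (2 * ν) ≤ N ^ 2 * X * 0.77 := by
      calc ((N : ℝ) + 1) * (2 * ν) ≤ (N + 1) * (X * (0.5775 * N)) := by
            refine mul_le_mul_of_nonneg_left (hνX.trans ?_) (by positivity)
            gcongr
        _ ≤ (4 / 3 * N) * (X * (0.5775 * N)) := by gcongr; linarith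
        _ = _ := by ring
    push_cast at h1
    calc _ ≤ ((N + 1) * (2 * ν)) * q * (1 - ν * q)⁻¹ ^ (N + 2) := by
          rw [add_assoc N 1 1, one_add_one_eq_two] at h1
          linarith
      _ ≤ (N ^ 2 * X * 0.77) * q * (1 - 5 / 3 * w)⁻¹ := by
          have : 0 < 1 - ν * q := by linarith
          gcongr
      _ = _ := by ring
  have hsecond : 2 * X * N * q * (1 - ν * (2 * q))⁻¹ ^ (N + 1) / (1 - (ν + √N) * (2 * q)) ≤
      N ^ 2 * X * q * (2 / 3 / ((1 - 8 / 3 * w) * (1 - (2 / 3 * w + 1.155 * u)))) := by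
    have h2 : (1 - ν * (2 * q))⁻¹ ^ (N + 1) ≤ (1 - 8 / 3 * w)⁻¹ := by
      refine inv_pow_le_inv _ (by linarith) ?_ hd1
      push_cast
      linarith
    have h3 : 2 * N ≤ 2 / 3 * (N : ℝ) ^ 2 := by nlinarith
    calc 2 * X * N * q * (1 - ν * (2 * q))⁻¹ ^ (N + 1) / (1 - (ν + √N) * (2 * q))
        = (2 * N) * (X * q) * (1 - ν * (2 * q))⁻¹ ^ (N + 1) / (1 - (ν + √N) * (2 * q)) := by ring
      _ ≤ (2 / 3 * N ^ 2) * (X * q) * (1 - 8 / 3 * w)⁻¹ / (1 - (2 / 3 * w + 1.155 * u)) := by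
          have : 0 < 1 - ν * (2 * q) := by linarith
          gcongr
      _ = _ := by field_simp
  refine ⟨by linarith, (add_le_add hfirst hsecond).trans ?_⟩
  rw [← mul_add]
  refine (mul_le_mul_of_nonneg_left hmain (by positivity)).trans (le_of_eq ?_)
  rw [hudef]
  ring

end Estimates

section Assembly

theorem exists_norm_eq_one_inner_eq_zero {V : Type*} [NormedAddCommGroup V] [InnerProductSpace ℂ V]
    [FiniteDimensional ℂ V] (hV : 2 ≤ Module.finrank ℂ V) (a : V) :
    ∃ v : V, ‖v‖ = 1 ∧ inner ℂ a v = 0 := by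
  have h1 := (ℂ ∙ a).finrank_add_finrank_orthogonal
  have h2 : Module.finrank ℂ (ℂ ∙ a) ≤ 1 := by simpa using finrank_span_le_card (R := ℂ) {a}
  have : Nontrivial (ℂ ∙ a)ᗮ := Module.nontrivial_of_finrank_pos (R := ℂ) (by omega)
  obtain ⟨v, hv⟩ := exists_norm_eq (ℂ ∙ a)ᗮ zero_le_one
  exact ⟨v, hv, Submodule.mem_orthogonal_singleton_iff_inner_right.1 v.2⟩

theorem exists_equiv_of_norm_symm_comp_sub_id_le {V W : Type*} [NormedAddCommGroup V]
    [NormedSpace ℂ V] [CompleteSpace V] [NormedAddCommGroup W] [NormedSpace ℂ W] (A : V ≃L[ℂ] W)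
    (D : V →L[ℂ] W) {ε : ℝ} (hε : ε < 1) (h : ‖(A.symm : W →L[ℂ] V) ∘L D - .id ℂ V‖ ≤ ε) :
    ∃ B : V ≃L[ℂ] W, (B : V →L[ℂ] W) = D ∧
      ‖(B.symm : W →L[ℂ] V) ∘L (A : V →L[ℂ] W)‖ ≤ (1 - ε)⁻¹ := by
  set t : V →L[ℂ] V := .id ℂ V - (A.symm : W →L[ℂ] V) ∘L D with ht
  have htn : ‖t‖ ≤ ε := by rwa [ht, norm_sub_rev]
  let T : V ≃L[ℂ] V := ContinuousLinearEquiv.ofUnit (Units.oneSub t (htn.trans_lt hε))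
  have hT : ∀ v, T v = v - t v := fun v => rfl
  have hTA : ∀ v, T v = A.symm (D v) := fun v => by rw [hT, ht]; simp
  refine ⟨T.trans A, by ext v; simp [hTA], ?_⟩
  refine ContinuousLinearMap.opNorm_le_bound _ (inv_nonneg.2 (by linarith)) fun v => ?_
  have e : ((T.trans A).symm : W →L[ℂ] V).comp (A : V →L[ℂ] W) v = T.symm v := by simp
  rw [e, inv_mul_eq_div, le_div_iff₀ (by linarith)]
  set w := T.symm v with hw
  have hv : v = w - t w := by rw [← hT, hw, T.apply_symm_apply]
  have h1 : ‖t w‖ ≤ ε * ‖w‖ := (t.le_opNorm w).trans (by gcongr)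
  have h2 : ‖w‖ - ‖t w‖ ≤ ‖v‖ := hv ▸ norm_sub_norm_le w (t w)
  linarith

theorem lt_one_of_lt_one_sub_sqrt {γ u : ℝ} (hγ : 1 ≤ γ) (hu : u < 1 - √(γ / (1 + γ))) :
    u < 1 ∧ γ * ((1 - u)⁻¹ ^ 2 - 1) < 1 ∧
      (1 - γ * ((1 - u)⁻¹ ^ 2 - 1))⁻¹ = (1 - u) ^ 2 / ((1 + γ) * (1 - u) ^ 2 - γ) := by
  have h0 := Real.sqrt_nonneg (γ / (1 + γ))
  have hu1 : 0 < 1 - u := by linarith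
  have h1 : γ / (1 + γ) < (1 - u) ^ 2 := (Real.sqrt_lt' hu1).1 (by linarith)
  rw [div_lt_iff₀ (by linarith)] at h1
  have e : 1 - γ * ((1 - u)⁻¹ ^ 2 - 1) = ((1 + γ) * (1 - u) ^ 2 - γ) / (1 - u) ^ 2 := by
    field_simp
    ring
  refine ⟨by linarith, ?_, by rw [e, inv_div]⟩
  have : 0 < ((1 + γ) * (1 - u) ^ 2 - γ) / (1 - u) ^ 2 := div_pos (by linarith) (by positivity)
  linarith

variable {V W : Type*} [NormedAddCommGroup V] [InnerProductSpace ℂ V] [InnerProductSpace ℝ V]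
  [IsScalarTower ℝ ℂ V] [FiniteDimensional ℝ V] [FiniteDimensional ℂ V] [MeasurableSpace V]
  [BorelSpace V] [NormedAddCommGroup W] [NormedSpace ℂ W] [CompleteSpace W]

theorem volume_real_unitBall [Nontrivial V] : volume.real (ball (0 : V) 1) =
    Real.pi ^ Module.finrank ℂ V / (Module.finrank ℂ V).factorial := by
  rw [Measure.real, InnerProductSpace.volume_ball_of_dim_even finrank_real_eq_two_mul]
  simp only [ENNReal.ofReal_one, one_pow, one_mul]
  exact ENNReal.toReal_ofReal (by positivity)

variable {σ R : ℝ} {a ω : V}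

/-- Quantitative invertibility of the derivative near a regular zero. -/
theorem exists_fderiv_equiv_near_zero {f : V → W} (hV : 2 ≤ Module.finrank ℂ V)
    (hf : DifferentiableOn ℂ f (ball ω R))
    (hint : IntegrableOn (fun z => ‖f z‖ ^ 2) (ball ω R)) (hσ : 0 < σ)
    (h : σ ^ 2 = 1 - ‖a‖ ^ 2) (hR : 0 < R) {M : ℝ} (hM : 0 ≤ M)
    (hfM : ∫ z in ball ω R, ‖f z‖ ^ 2 ≤ R ^ (2 * Module.finrank ℂ V) *
      σ ^ (2 * (Module.finrank ℂ V + 1)) * (M ^ 2 * volume.real (ball (0 : V) 1)))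
    (h0 : f (ω + (R : ℂ) • a) = 0) (A : V ≃L[ℂ] W)
    (hA : (A : V →L[ℂ] W) = fderiv ℂ f (ω + (R : ℂ) • a)) {κ γ : ℝ}
    (hκ : (Module.finrank ℂ V + 1) / (R * σ ^ 2) ≤ κ) (hγ1 : 1 ≤ γ)
    (hγ : M * κ * ‖(A.symm : W →L[ℂ] V)‖ ≤ γ) {x : V}
    (hx : κ * ‖x - (ω + (R : ℂ) • a)‖ < 1 - √(γ / (1 + γ))) :
    ∃ B : V ≃L[ℂ] W, (B : V →L[ℂ] W) = fderiv ℂ f x ∧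
      ‖(B.symm : W →L[ℂ] V) ∘L (A : V →L[ℂ] W)‖ ≤
        (1 - κ * ‖x - (ω + (R : ℂ) • a)‖) ^ 2 /
          ((1 + γ) * (1 - κ * ‖x - (ω + (R : ℂ) • a)‖) ^ 2 - γ) := by
  have hkernel := (kernel_expansion hf hint hσ h hR hM hfM h0).1
  set m := Module.finrank ℂ V with hm
  set ζ := ω + (R : ℂ) • a with hζ
  set u := κ * ‖x - ζ‖ with hu
  obtain ⟨hu1, hε, heq⟩ := lt_one_of_lt_one_sub_sqrt hγ1 hx
  rw [← heq]
  refine exists_equiv_of_norm_symm_comp_sub_id_le A _ hε ?_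
  have hσR : 0 < σ ^ 2 * R := by positivity
  have hκ0 : 0 < κ := lt_of_lt_of_le (by positivity) hκ
  have hu0 : 0 ≤ u := by positivity
  have ha : ‖a‖ < 1 := by nlinarith [norm_nonneg a, pow_pos hσ 2]
  rcases eq_or_ne x ζ with hxζ | hne
  · have : (A.symm : W →L[ℂ] V) ∘L fderiv ℂ f x - .id ℂ V = 0 := by
      rw [hxζ, ← hA]; ext v; simp
    rw [this, hu, hxζ]
    simp
  set X := ‖(A.symm : W →L[ℂ] V)‖ * M / (σ ^ 2 * R) with hX
  have hXN : 1 ≤ X * (√(m + 1) * σ) := by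
    obtain ⟨v, hv, hav⟩ := exists_norm_eq_one_inner_eq_zero hV a
    have h1 := hkernel v
    rw [coshrink_apply, hav, mul_zero, zero_smul, add_zero, norm_smul, hv, mul_one,
      Complex.norm_real, Real.norm_of_nonneg hσ.le, ← hA] at h1
    have h2 : 1 ≤ ‖(A.symm : W →L[ℂ] V)‖ * ‖A v‖ := by
      simpa [hv] using (A.symm : W →L[ℂ] V).le_opNorm (A v)
    rw [hX, div_mul_eq_mul_div, le_div_iff₀ hσR, one_mul]
    calc σ ^ 2 * R ≤ ‖(A.symm : W →L[ℂ] V)‖ * (σ ^ 2 * R * ‖A v‖) := by nlinarith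
      _ ≤ ‖(A.symm : W →L[ℂ] V)‖ * (√(m + 1) * M * σ) :=
        mul_le_mul_of_nonneg_left h1 (norm_nonneg _)
      _ = _ := by ring
  have hX0 : 0 < X := pos_of_mul_pos_left (zero_lt_one.trans_le hXN) (by positivity)
  have hXN2 : 1 ≤ X ^ 2 * ((m + 1 : ℕ) * (1 - ‖a‖ ^ 2)) := by
    calc (1 : ℝ) ≤ (X * (√(m + 1) * σ)) ^ 2 := one_le_pow₀ hXN
      _ = _ := by rw [mul_pow, mul_pow, Real.sq_sqrt (by positivity), h]; push_cast; rfl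
  set η : V := ((σ : ℂ) ^ 2 * R)⁻¹ • (x - ζ) with hη
  have hc : (σ : ℂ) ^ 2 * R ≠ 0 := by exact_mod_cast hσR.ne'
  have hxη : ζ + ((σ : ℂ) ^ 2 * R) • η = x := by
    rw [hη, smul_inv_smul₀ hc, add_sub_cancel]
  have hηn : ‖η‖ = ‖x - ζ‖ / (σ ^ 2 * R) := by
    rw [hη, norm_smul, norm_inv, ← Complex.ofReal_pow, ← Complex.ofReal_mul, Complex.norm_real,
      Real.norm_of_nonneg hσR.le, inv_mul_eq_div]
  have hη0 : 0 < ‖η‖ := by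
    rw [hηn]
    exact div_pos (norm_pos_iff.2 (sub_ne_zero.2 hne)) hσR
  have hNq : ((m + 1 : ℕ) : ℝ) * ‖η‖ ≤ u := by
    calc ((m + 1 : ℕ) : ℝ) * ‖η‖ = (m + 1) / (R * σ ^ 2) * ‖x - ζ‖ := by
          rw [hηn]; push_cast; ring
      _ ≤ u := mul_le_mul_of_nonneg_right hκ (norm_nonneg _)
  have hNX : ((m + 1 : ℕ) : ℝ) * X ≤ γ := by
    calc ((m + 1 : ℕ) : ℝ) * X = M * ((m + 1) / (R * σ ^ 2)) * ‖(A.symm : W →L[ℂ] V)‖ := by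
          rw [hX]; push_cast; ring
      _ ≤ M * κ * ‖(A.symm : W →L[ℂ] V)‖ := by gcongr
      _ ≤ γ := hγ
  have hmono : ((m + 1 : ℕ) : ℝ) * X * ((1 - (m + 1 : ℕ) * ‖η‖)⁻¹ ^ 2 - 1) ≤
      γ * ((1 - u)⁻¹ ^ 2 - 1) := by
    have h1 : (1 - ((m + 1 : ℕ) : ℝ) * ‖η‖)⁻¹ ≤ (1 - u)⁻¹ :=
      inv_anti₀ (by linarith) (by linarith)
    have h2 : 1 ≤ (1 - ((m + 1 : ℕ) : ℝ) * ‖η‖)⁻¹ :=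
      (one_le_inv₀ (by linarith)).2 (by linarith [show 0 ≤ ((m + 1 : ℕ) : ℝ) * ‖η‖ by positivity])
    have h3 := one_le_pow₀ h2 (n := 2)
    have h4 : 0 ≤ (1 - ((m + 1 : ℕ) : ℝ) * ‖η‖)⁻¹ ^ 2 - 1 := by linarith
    gcongr
  obtain ⟨hq, hb⟩ := derivative_bound_le (by omega) (norm_nonneg a) ha hη0.le hX0 hXN2
    (hNq.trans_lt hu1) (hmono.trans hε.le)
  have hcast : ((m + 1 : ℕ) : ℝ) = m + 1 := by push_cast; rfl
  have key := norm_symm_comp_fderiv_sub_id_le hf hint hσ h hR hM hfM h0 A hA hη0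
    (by rwa [hcast] at hq)
  rw [← hζ, hxη] at key
  refine key.trans (le_trans (le_of_eq ?_) (hb.trans hmono))
  rw [hcast, ← hm, ← hX]
  ring

end Assembly

theorem sq_A2Norm {𝓕 : Type*} [NormedAddCommGroup 𝓕] {n : ℕ} (ω : En n) {R : ℝ} (hR : 0 < R)
    (f : En n → 𝓕) : A2Norm ω R f ^ 2 =
      (n.factorial : ℝ) / (Real.pi ^ n * R ^ (2 * n)) * ∫ z in ball ω R, ‖f z‖ ^ 2 := by
  have h0 : 0 ≤ ∫ z in ball ω R, ‖f z‖ ^ 2 := integral_nonneg fun z => sq_nonneg _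
  have h1 : 0 ≤ (n.factorial : ℝ) / (Real.pi ^ n * R ^ (2 * n)) := by positivity
  exact Real.sq_sqrt (mul_nonneg h1 h0)

theorem integral_norm_sq_eq_of_mul_rpow_eq_A2Norm {𝓕 : Type*} [NormedAddCommGroup 𝓕] {n : ℕ}
    [NeZero n] {ω : En n} {R : ℝ} (hR : 0 < R) {f : En n → 𝓕} {s M : ℝ} (hs : 0 < s)
    (h : M * s ^ (((n : ℝ) + 1) / 2) = A2Norm ω R f) :
    ∫ z in ball ω R, ‖f z‖ ^ 2 = R ^ (2 * Module.finrank ℂ (En n)) *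
      √s ^ (2 * (Module.finrank ℂ (En n) + 1)) * (M ^ 2 * volume.real (ball (0 : En n) 1)) := by
  have h1 : (s ^ (((n : ℝ) + 1) / 2)) ^ 2 = s ^ (n + 1) := by
    rw [← Real.rpow_mul_natCast hs.le, ← Real.rpow_natCast s]
    congr 1
    push_cast
    ring
  have h2 := sq_A2Norm ω hR f
  rw [← h, mul_pow, h1] at h2
  rw [volume_real_unitBall, finrank_euclideanSpace_fin, pow_mul √s, Real.sq_sqrt hs.le]
  generalize ∫ z in ball ω R, ‖f z‖ ^ 2 = I at h2 ⊢
  have e : R ^ (2 * n) * s ^ (n + 1) * (M ^ 2 * (Real.pi ^ n / n.factorial)) =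
    R ^ (2 * n) * (Real.pi ^ n / n.factorial) * (M ^ 2 * s ^ (n + 1)) := by ring
  rw [e, h2]
  have := Real.pi_pos
  have := n.factorial_pos
  field_simp

/-- Let `ζ ∈ B(ω,R)` be a zero of `f = (f₁,…,f_n) ∈ A²(ω,R)^n` with `Df(ζ)` invertible;
write `γ = γ(f,ζ)`, `κ = κ_ζ`, and for `x ∈ B(ω,R)` set `u = κ‖x−ζ‖`.  If
`u < 1 − √(γ/(1+γ))`, then `Df(x)` is invertible and
`‖Df(x)⁻¹ Df(ζ)‖ ≤ (1−u)²/((1+γ)(1−u)² − γ)`. -/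
theorem stmt13 (n : ℕ) (hn : 2 ≤ n) (ω : En n) (R : ℝ) (hR : 0 < R)
    (f : En n → En n) (hf : MemA2 ω R f)
    (ζ : En n) (hζ : ζ ∈ ball ω R) (hfζ : f ζ = 0)
    (A : En n ≃L[ℂ] En n) (hA : (A : En n →L[ℂ] En n) = fderiv ℂ f ζ) :
    let ν : ℝ := ‖ζ - ω‖ / R
    let κ : ℝ := max 1 (((n : ℝ) + 1) / (R * (1 - ν ^ 2)))
    let lam : ℝ := A2Norm ω R f / (1 - ν ^ 2) ^ (((n : ℝ) + 1) / 2)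
    let γ : ℝ := max 1 (lam * κ * ‖(A.symm : En n →L[ℂ] En n)‖)
    ∀ x ∈ ball ω R,
      κ * ‖x - ζ‖ < 1 - Real.sqrt (γ / (1 + γ)) →
      ∃ B : En n ≃L[ℂ] En n, (B : En n →L[ℂ] En n) = fderiv ℂ f x ∧
        ‖(B.symm : En n →L[ℂ] En n).comp (fderiv ℂ f ζ)‖ ≤
          (1 - κ * ‖x - ζ‖) ^ 2 / ((1 + γ) * (1 - κ * ‖x - ζ‖) ^ 2 - γ) := by
  intro ν κ lam γ x _ hx
  have : NeZero n := ⟨by omega⟩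
  have hfin : Module.finrank ℂ (En n) = n := finrank_euclideanSpace_fin
  set a : En n := (R : ℂ)⁻¹ • (ζ - ω) with ha
  have hRc : (R : ℂ) ≠ 0 := by exact_mod_cast hR.ne'
  have hζa : ω + (R : ℂ) • a = ζ := by rw [ha, smul_inv_smul₀ hRc, add_sub_cancel]
  have han : ‖a‖ = ν := by
    rw [ha, norm_smul, norm_inv, Complex.norm_real, Real.norm_of_nonneg hR.le, inv_mul_eq_div]
  have hν0 : 0 ≤ ν := by positivity
  have hν1 : ν < 1 := by
    rw [div_lt_one hR, ← dist_eq_norm]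
    exact hζ
  have hs : 0 < 1 - ν ^ 2 := by nlinarith
  have hσ2 : √(1 - ν ^ 2) ^ 2 = 1 - ν ^ 2 := Real.sq_sqrt hs.le
  have hlam0 : 0 ≤ lam := div_nonneg (Real.sqrt_nonneg _) (Real.rpow_nonneg hs.le _)
  have hlam : lam * (1 - ν ^ 2) ^ (((n : ℝ) + 1) / 2) = A2Norm ω R f :=
    div_mul_cancel₀ _ (Real.rpow_pos_of_pos hs _).ne'
  have hfM := integral_norm_sq_eq_of_mul_rpow_eq_A2Norm hR hs hlam
  have key := exists_fderiv_equiv_near_zero (σ := √(1 - ν ^ 2)) (κ := κ) (γ := γ) (x := x)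
    (by rwa [hfin]) hf.1.differentiableOn hf.2 (Real.sqrt_pos.2 hs) (by rw [hσ2, han]) hR hlam0
    hfM.le (by rwa [hζa]) A (by rwa [hζa]) (by rw [hfin, hσ2]; exact le_max_right _ _)
    (le_max_left _ _) (le_max_right _ _) (by rwa [hζa])
  rwa [hζa, hA] at key
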